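/- Let k ≥ 1 and m ≥ 0 be integers. If X is a metric space with dim X ≥ k + m, then there exists a closed ∂Δ^k-tuple ℱ of X such that every ∂Δ^k-neighbourhood 𝒰 of ℱ satisfies the following alternative: dim ∂Δ^k-obs(𝒰) = m, or the corresponding ∂Δ^k-partition P = X \ ⋃𝒰 has dim P > m. In particular, if n ≥ 1 and dim X = k(n+1) − 1, then ∂Δ^k-Ind X = n and ∂Δ^k-str X = 1. -/

import Mathlib

open Set Topology Cardinal

noncomputable section

attribute [local instance] Classical.propDecidable

/-- Values of dimension functions: `⊥ : WithBot Ordinal.{0}` encodes `−1`,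
ordinals are the usual values, and `⊤` encodes `∞`. -/
abbrev Dim : Type 1 := WithTop (WithBot Ordinal.{0})

/-- An ordinal viewed as a dimension value. -/
def Dim.ofOrdinal (a : Ordinal.{0}) : Dim := ((a : WithBot Ordinal.{0}) : Dim)

/-- The dimension value `−1`. -/
def Dim.minusOne : Dim := ((⊥ : WithBot Ordinal.{0}) : Dim)

/-- An integer `m ≥ −1` viewed as a dimension value. -/
def Dim.ofInt (m : ℤ) : Dim := if 0 ≤ m then Dim.ofOrdinal m.toNat else Dim.minusOne

/-- `A` is a `K`-tuple for the simplicial complex `K` on the vertex set `Fin m`: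
whenever the members indexed by a nonempty `I` have a common point, `I` spans a
simplex of `K`. -/
def IsKTuple {m : ℕ} (K : Finset (Fin m) → Prop) {X : Type} (A : Fin m → Set X) : Prop :=
  ∀ I : Finset (Fin m), I.Nonempty → (⋂ i ∈ I, A i).Nonempty → K I

/-- `K` is an abstract (finite) simplicial complex with vertex set `Fin m`:
it is closed under passing to nonempty subsets, and contains every vertex. -/
def IsComplex {m : ℕ} (K : Finset (Fin m) → Prop) : Prop :=
  (∀ s t : Finset (Fin m), s ⊆ t → s.Nonempty → K t → K s) ∧ ∀ i, K {i}

/-- The boundary complex `∂Δ^k` of the `k`-simplex: all proper subsets of the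
`k+1` vertices span simplices. -/
def bComplex (k : ℕ) : Finset (Fin (k + 1)) → Prop := fun s => s ≠ Finset.univ

/-- `U` is an (open) `K`-neighbourhood of the tuple `F`. -/
def KNbhd {m : ℕ} (K : Finset (Fin m) → Prop) {X : Type} [TopologicalSpace X]
    (F U : Fin m → Set X) : Prop :=
  (∀ i, IsOpen (U i)) ∧ IsKTuple K U ∧ ∀ i, F i ⊆ U i

/-- Auxiliary form of `K-Ind X ≤ α`, defined by transfinite recursion on `α`:
every closed `K`-tuple has a `K`-neighbourhood whose corresponding `K`-partition
is either empty (dimension `−1`) or has `K-Ind < α`. -/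
def KIndLeAux {m : ℕ} (K : Finset (Fin m) → Prop) :
    Ordinal.{0} → ∀ X : Type, TopologicalSpace X → Prop :=
  (wellFounded_lt (α := Ordinal.{0})).fix fun α rec X tX =>
    letI := tX
    ∀ F : Fin m → Set X, (∀ i, IsClosed (F i)) → IsKTuple K F →
      ∃ U : Fin m → Set X, (∀ i, IsOpen (U i)) ∧ IsKTuple K U ∧ (∀ i, F i ⊆ U i) ∧
        ((⋃ i, U i)ᶜ = (∅ : Set X) ∨
          ∃ β : Set.Iio α, rec β.1 β.2 (↥((⋃ i, U i)ᶜ)) inferInstance)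

/-- `K-Ind X ≤ α` (for an ordinal `α ≥ 0`). -/
def KIndLE {m : ℕ} (K : Finset (Fin m) → Prop) (X : Type) [tX : TopologicalSpace X]
    (α : Ordinal.{0}) : Prop :=
  KIndLeAux K α X tX

/-- Fedorchuk's inductive dimension `K-Ind` modulo a simplicial complex `K`;
`−1` for the empty space, the least `α` with `K-Ind X ≤ α` otherwise, `∞` if none. -/
def KInd {m : ℕ} (K : Finset (Fin m) → Prop) (X : Type) [TopologicalSpace X] : Dim :=
  if IsEmpty X then Dim.minusOne
  else if ∃ α, KIndLE K X α then Dim.ofOrdinal (sInf {α | KIndLE K X α}) else ⊤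

/-- The set of `K`-obstruction points of an open `K`-tuple `U`: points covered
by no `K`-neighbourhood of `U`. -/
def KObs {m : ℕ} (K : Finset (Fin m) → Prop) {X : Type} [TopologicalSpace X]
    (U : Fin m → Set X) : Set X :=
  {x | ¬ ∃ V : Fin m → Set X, KNbhd K U V ∧ x ∈ ⋃ i, V i}

/-- `X` is strongly `α`-dimensional: `K-Ind X` is a positive ordinal `α` and some
closed `K`-tuple admits no `K`-neighbourhood `U` without obstruction points whose
corresponding `K`-partition has `K-Ind < α`. -/
def KStrongly {m : ℕ} (K : Finset (Fin m) → Prop) (X : Type) [TopologicalSpace X] : Prop :=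
  (∃ α : Ordinal.{0}, 0 < α ∧ KInd K X = Dim.ofOrdinal α) ∧
  ∃ F : Fin m → Set X, (∀ i, IsClosed (F i)) ∧ IsKTuple K F ∧
    ∀ U : Fin m → Set X, KNbhd K F U →
      KInd K (↥((⋃ i, U i)ᶜ)) < KInd K X → KObs K U ≠ ∅

/-- The dimensional strength degree `K-str X ∈ {0,1}`. -/
def KStr {m : ℕ} (K : Finset (Fin m) → Prop) (X : Type) [TopologicalSpace X] : ℕ :=
  if KStrongly K X then 1 else 0

/-- `K-dim X ≤ n`: any `n+1` closed `K`-tuples admit `K`-partitions with empty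
intersection. -/
def KDimLE {m : ℕ} (K : Finset (Fin m) → Prop) (X : Type) [TopologicalSpace X] (n : ℕ) : Prop :=
  ∀ F : Fin (n + 1) → Fin m → Set X,
    (∀ j i, IsClosed (F j i)) → (∀ j, IsKTuple K (F j)) →
    ∃ U : Fin (n + 1) → Fin m → Set X, (∀ j, KNbhd K (F j) (U j)) ∧
      (⋂ j, (⋃ i, U j i)ᶜ) = (∅ : Set X)

/-- Fedorchuk's dimension `K-dim` modulo a simplicial complex `K`. -/
def KDim {m : ℕ} (K : Finset (Fin m) → Prop) (X : Type) [TopologicalSpace X] : Dim :=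
  if IsEmpty X then Dim.minusOne
  else if ∃ n, KDimLE K X n then Dim.ofOrdinal ((sInf {n | KDimLE K X n} : ℕ) : Ordinal.{0}) else ⊤

/-- `dim X ≤ n` for the Lebesgue covering dimension: every finite open cover has
an open shrinking of order at most `n+1`. -/
def CovDimLE (X : Type) [TopologicalSpace X] (n : ℕ) : Prop :=
  ∀ (ι : Type), Finite ι → ∀ U : ι → Set X, (∀ i, IsOpen (U i)) → (⋃ i, U i) = Set.univ →
    ∃ V : ι → Set X, (∀ i, IsOpen (V i)) ∧ (∀ i, V i ⊆ U i) ∧ (⋃ i, V i) = Set.univ ∧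
      ∀ x : X, ({i | x ∈ V i}).ncard ≤ n + 1

/-- The Lebesgue covering dimension. -/
def covDim (X : Type) [TopologicalSpace X] : Dim :=
  if IsEmpty X then Dim.minusOne
  else if ∃ n, CovDimLE X n then Dim.ofOrdinal ((sInf {n | CovDimLE X n} : ℕ) : Ordinal.{0}) else ⊤

/-- `Ind X ≤ n` for the large inductive dimension, by recursion on `n`. -/
def IndLE : ℕ → ∀ X : Type, TopologicalSpace X → Prop
  | 0, X, tX =>
    letI := tX
    ∀ F U : Set X, IsClosed F → IsOpen U → F ⊆ U →
      ∃ V : Set X, IsOpen V ∧ F ⊆ V ∧ V ⊆ U ∧ frontier V = ∅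
  | n + 1, X, tX =>
    letI := tX
    ∀ F U : Set X, IsClosed F → IsOpen U → F ⊆ U →
      ∃ V : Set X, IsOpen V ∧ F ⊆ V ∧ V ⊆ U ∧ IndLE n (↥(frontier V)) inferInstance

/-- The large inductive dimension `Ind`. -/
def IndDim (X : Type) [tX : TopologicalSpace X] : Dim :=
  if IsEmpty X then Dim.minusOne
  else if ∃ n, IndLE n X tX then Dim.ofOrdinal ((sInf {n | IndLE n X tX} : ℕ) : Ordinal.{0}) else ⊤

/-- The relation generating the topological join `A ∗ B`: the copy of `B` is
collapsed at parameter `0`, the copy of `A` at parameter `1`. -/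
def JoinRel (A B : Type) : (A × B × unitInterval) → (A × B × unitInterval) → Prop :=
  fun p q => (p.2.2 = 0 ∧ q.2.2 = 0 ∧ p.1 = q.1) ∨ (p.2.2 = 1 ∧ q.2.2 = 1 ∧ p.2.1 = q.2.1)

/-- The topological join `A ∗ B`. -/
abbrev Join (A B : Type) [TopologicalSpace A] [TopologicalSpace B] : Type :=
  Quot (JoinRel A B)

/-- Auxiliary construction of the join of `n+1` copies of `L`, bundled with its
topology. -/
def JoinPowAux (L : Type) (tL : TopologicalSpace L) : ℕ → (T : Type) × TopologicalSpace T
  | 0 => ⟨L, tL⟩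
  | n + 1 =>
    let p := JoinPowAux L tL n
    letI := tL
    letI := p.2
    ⟨Join L p.1, inferInstance⟩

/-- The join `L ∗ ⋯ ∗ L` of `n+1` copies of `L`. -/
def JoinPow (L : Type) [tL : TopologicalSpace L] (n : ℕ) : Type :=
  (JoinPowAux L tL n).1

instance joinPowTopologicalSpace (L : Type) [tL : TopologicalSpace L] (n : ℕ) :
    TopologicalSpace (JoinPow L n) :=
  (JoinPowAux L tL n).2

/-- `L-dim X ≤ n`: every continuous map from a closed subset of `X` to the join
of `n+1` copies of `L` extends continuously over `X`. -/
def LDimLE (L : Type) [TopologicalSpace L] (X : Type) [TopologicalSpace X] (n : ℕ) : Prop :=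
  ∀ F : Set X, IsClosed F → ∀ f : C(F, JoinPow L n),
    ∃ g : C(X, JoinPow L n), ∀ x : F, g x = f x

/-- Fedorchuk's dimension `L-dim` modulo an ANR `L`. -/
def LDim (L : Type) [TopologicalSpace L] (X : Type) [TopologicalSpace X] : Dim :=
  if IsEmpty X then Dim.minusOne
  else if ∃ n, LDimLE L X n then Dim.ofOrdinal ((sInf {n | LDimLE L X n} : ℕ) : Ordinal.{0}) else ⊤

/-- Auxiliary form of `L-Ind X ≤ α`, by transfinite recursion on `α`: every map
to `L` from a closed subset of `X` has an `L`-partition which is either empty or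
has `L-Ind < α`. -/
def LIndLeAux (L : Type) [TopologicalSpace L] :
    Ordinal.{0} → ∀ X : Type, TopologicalSpace X → Prop :=
  (wellFounded_lt (α := Ordinal.{0})).fix fun α rec X tX =>
    letI := tX
    ∀ F : Set X, IsClosed F → ∀ f : C(F, L),
      ∃ U : Set X, IsOpen U ∧ ∃ hFU : F ⊆ U,
        (∃ g : C(U, L), ∀ (x : X) (hx : x ∈ F), g ⟨x, hFU hx⟩ = f ⟨x, hx⟩) ∧
        (Uᶜ = (∅ : Set X) ∨ ∃ β : Set.Iio α, rec β.1 β.2 (↥(Uᶜ)) inferInstance)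

/-- `L-Ind X ≤ α` (for an ordinal `α ≥ 0`). -/
def LIndLE (L : Type) [TopologicalSpace L] (X : Type) [tX : TopologicalSpace X]
    (α : Ordinal.{0}) : Prop :=
  LIndLeAux L α X tX

/-- Fedorchuk's inductive dimension `L-Ind` modulo an ANR `L`. -/
def LInd (L : Type) [TopologicalSpace L] (X : Type) [TopologicalSpace X] : Dim :=
  if IsEmpty X then Dim.minusOne
  else if ∃ α, LIndLE L X α then Dim.ofOrdinal (sInf {α | LIndLE L X α}) else ⊤

/-- `L` is an absolute neighbourhood retract (for metric spaces): `L` is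
metrizable and whenever a closed subset `A` of a metric space is homeomorphic to
`L` via `e`, the map `e` extends continuously over a neighbourhood of `A`. -/
def IsANR (L : Type) [TopologicalSpace L] : Prop :=
  TopologicalSpace.MetrizableSpace L ∧
  ∀ (M : Type) [MetricSpace M], ∀ A : Set M, IsClosed A → ∀ e : A ≃ₜ L,
    ∃ U : Set M, IsOpen U ∧ ∃ hAU : A ⊆ U, ∃ r : C(U, L),
      ∀ (a : M) (ha : a ∈ A), r ⟨a, hAU ha⟩ = e ⟨a, ha⟩

/-- `L-Ind_{b+} X`: the least dimension value `d` such that some open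
neighbourhood of `b` has closure of `L-Ind` at most `d`. -/
def LIndPlus (L : Type) [TopologicalSpace L] {X : Type} [TopologicalSpace X] (b : X) : Dim :=
  sInf {d : Dim | ∃ U : Set X, IsOpen U ∧ b ∈ U ∧ LInd L (↥(closure U)) ≤ d}

/-- The set `K(X) = {b ∈ X : L-Ind_{b+} X = L-Ind X}`. -/
def LKset (L : Type) [TopologicalSpace L] (X : Type) [TopologicalSpace X] : Set X :=
  {b | LIndPlus L b = LInd L X}

/-- The weight of a topological space: the least cardinality of a basis. -/
def tWeight (X : Type) [TopologicalSpace X] : Cardinal :=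
  sInf {c | ∃ B : Set (Set X), TopologicalSpace.IsTopologicalBasis B ∧ #B = c}

/-- The family `𝒮_X` of all subsets of `X` that are finite or homeomorphic to the
one-point compactification `A_{ℵ₀}` of a countably infinite discrete space. -/
def SFam (X : Type) [TopologicalSpace X] : Set (Set X) :=
  {S | S.Finite ∨ Nonempty (↥S ≃ₜ OnePoint ℕ)}

/-- The relation generating the quotient `N` in the `Z(X,Y)` construction:
each set `{μ} × {x} × Y` is collapsed to a point. -/
def ZRel (ι X Y : Type) : (OnePoint ι × X × Y) → (OnePoint ι × X × Y) → Prop :=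
  fun p q => p.1 = OnePoint.infty ∧ q.1 = OnePoint.infty ∧ p.2.1 = q.2.1

/-- The quotient space `N` of `A_𝔪 × X × Y`. -/
abbrev ZQuot (ι X Y : Type) [TopologicalSpace ι] [TopologicalSpace X] [TopologicalSpace Y] :
    Type :=
  Quot (ZRel ι X Y)

/-- The subset `Z(X,Y) = ⋃_{α ∈ A_𝔪} H(α)` of `N`:  `H(μ) = π₁({μ} × X × Y)` and
`H(α) = π₁({α} × φ(α) × Y)` for `α ≠ μ`. -/
def ZSet (ι X Y : Type) [TopologicalSpace ι] [TopologicalSpace X] [TopologicalSpace Y]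
    (φ : ι → Set X) : Set (ZQuot ι X Y) :=
  {z | ∃ p : OnePoint ι × X × Y, Quot.mk (ZRel ι X Y) p = z ∧
        (p.1 = OnePoint.infty ∨ ∃ i : ι, p.1 = (i : OnePoint ι) ∧ p.2.1 ∈ φ i)}

/-- The space `Z(X,Y)` (for the data `ι`, `φ`), with the subspace topology. -/
abbrev ZSpace (ι X Y : Type) [TopologicalSpace ι] [TopologicalSpace X] [TopologicalSpace Y]
    (φ : ι → Set X) : Type :=
  ↥(ZSet ι X Y φ)

/-- The subset `H(μ)` of `Z(X,Y)`. -/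
def ZHmu (ι X Y : Type) [TopologicalSpace ι] [TopologicalSpace X] [TopologicalSpace Y]
    (φ : ι → Set X) : Set (ZSpace ι X Y φ) :=
  {z | ∃ (x : X) (y : Y), (z : ZQuot ι X Y) = Quot.mk (ZRel ι X Y) (OnePoint.infty, x, y)}

/-- The projection `π_X : N → X`, `π₁(α,x,y) ↦ x`. -/
def ZQuotProjX {ι X Y : Type} [TopologicalSpace ι] [TopologicalSpace X] [TopologicalSpace Y] :
    ZQuot ι X Y → X :=
  Quot.lift (fun p => p.2.1) (fun _ _ h => h.2.2)

/-- The projection `π_X : Z(X,Y) → X`. -/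
def ZProjX {ι X Y : Type} [TopologicalSpace ι] [TopologicalSpace X] [TopologicalSpace Y]
    (φ : ι → Set X) : ZSpace ι X Y φ → X :=
  fun z => ZQuotProjX (z : ZQuot ι X Y)

/-- The cardinality requirements on the index set `ι` (of cardinality `𝔪`) in the
`Z(X,Y)` construction: `𝔪 ≥ max {ℵ₀, (wX)⁺, (wY)⁺, card 𝒮_X}`. -/
def ZCardOK (X Y ι : Type) [TopologicalSpace X] [TopologicalSpace Y] : Prop :=
  ℵ₀ ≤ #ι ∧ tWeight X < #ι ∧ tWeight Y < #ι ∧ #(SFam X) ≤ #ι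

/-- The requirements on `φ : A_𝔪 \ {μ} → 𝒮_X`: it takes values in `𝒮_X` and every
fibre has cardinality `𝔪`. -/
def ZPhiOK {X ι : Type} [TopologicalSpace X] (φ : ι → Set X) : Prop :=
  (∀ i, φ i ∈ SFam X) ∧ ∀ S ∈ SFam X, #(↥(φ ⁻¹' {S})) = #ι


/-- Order form of the covering dimension: `dim X ≤ n - 1`. -/
def OrdLE (X : Type) [TopologicalSpace X] (n : ℕ) : Prop :=
  ∀ (ι : Type), Finite ι → ∀ U : ι → Set X, (∀ i, IsOpen (U i)) → (⋃ i, U i) = Set.univ →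
    ∃ V : ι → Set X, (∀ i, IsOpen (V i)) ∧ (∀ i, V i ⊆ U i) ∧ (⋃ i, V i) = Set.univ ∧
      ∀ x : X, ({i | x ∈ V i}).ncard ≤ n

lemma OrdLE.mono {X : Type} [TopologicalSpace X] {n n' : ℕ} (h : OrdLE X n) (hn : n ≤ n') :
    OrdLE X n' := by
  intro ι hι U hU hc
  obtain ⟨V, h1, h2, h3, h4⟩ := h ι hι U hU hc
  exact ⟨V, h1, h2, h3, fun x => (h4 x).trans hn⟩

lemma OrdLE.of_empty {X : Type} [TopologicalSpace X] (h : IsEmpty X) (n : ℕ) : OrdLE X n := by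
  intro ι hι U hU hc
  exact ⟨U, hU, fun _ => subset_rfl, hc, fun x => (h.false x).elim⟩

lemma OrdLE.isEmpty {X : Type} [TopologicalSpace X] (h : OrdLE X 0) : IsEmpty X := by
  obtain ⟨V, h1, h2, h3, h4⟩ := h Unit inferInstance (fun _ => Set.univ) (fun _ => isOpen_univ)
    (Set.iUnion_const _)
  refine ⟨fun x => ?_⟩
  have hx : x ∈ ⋃ i, V i := by rw [h3]; trivial
  obtain ⟨i, hi⟩ := mem_iUnion.1 hx
  have := h4 x
  rw [Nat.le_zero, Set.ncard_eq_zero] at this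
  exact (this ▸ (show i ∈ {i | x ∈ V i} from hi) : i ∈ (∅ : Set Unit))

lemma OrdLE.closedEmbedding {X Y : Type} [TopologicalSpace X] [TopologicalSpace Y] {n : ℕ}
    (h : OrdLE X n) {f : Y → X} (hf : IsClosedEmbedding f) : OrdLE Y n := by
  intro ι hι U hU hc
  rcases isEmpty_or_nonempty ι with he | he
  · refine ⟨U, hU, fun _ => subset_rfl, hc, fun x => ?_⟩
    have : x ∈ ⋃ i, U i := by rw [hc]; trivial
    obtain ⟨i, hi⟩ := mem_iUnion.1 this
    exact he.elim i
  · have : ∀ i, ∃ U' : Set X, IsOpen U' ∧ f ⁻¹' U' = U i := fun i =>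
      hf.isInducing.isOpen_iff.1 (hU i)
    choose U' hU' hUU using this
    obtain ⟨V, h1, h2, h3, h4⟩ := h ι hι (fun i => U' i ∪ (range f)ᶜ)
      (fun i => (hU' i).union hf.isClosed_range.isOpen_compl) (by
        rw [eq_univ_iff_forall]
        intro x
        by_cases hx : x ∈ range f
        · obtain ⟨y, rfl⟩ := hx
          have : y ∈ ⋃ i, U i := by rw [hc]; trivial
          obtain ⟨i, hi⟩ := mem_iUnion.1 this
          rw [← hUU] at hi
          exact mem_iUnion.2 ⟨i, Or.inl hi⟩
        · exact mem_iUnion.2 ⟨he.some, Or.inr hx⟩)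
    refine ⟨fun i => f ⁻¹' V i, fun i => (h1 i).preimage hf.continuous, ?_, ?_, fun y => h4 (f y)⟩
    · intro i y hy
      rcases h2 i hy with hy | hy
      · rw [← hUU]; exact hy
      · exact (hy ⟨y, rfl⟩).elim
    · rw [← preimage_iUnion, h3, preimage_univ]

/-- Criterion for the order via covers with `n+1` elements. -/
lemma ordLE_of_covers {X : Type} [TopologicalSpace X] {n : ℕ} {κ : Type} [Fintype κ]
    [Nonempty κ] (hκ : Fintype.card κ = n + 1)
    (h : ∀ W : κ → Set X, (∀ i, IsOpen (W i)) → (⋃ i, W i) = Set.univ →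
      ∃ V : κ → Set X, (∀ i, IsOpen (V i)) ∧ (∀ i, V i ⊆ W i) ∧ (⋃ i, V i) = Set.univ ∧
        (⋂ i, V i) = ∅) : OrdLE X n := by
  intro ι hι U hU hc
  have := Fintype.ofFinite ι
  have key : ∀ 𝓘 : Finset (Finset ι), ∃ V : ι → Set X, (∀ i, IsOpen (V i)) ∧ (∀ i, V i ⊆ U i) ∧
      (⋃ i, V i) = Set.univ ∧ ∀ I ∈ 𝓘, I.card = n + 1 → ∀ x, ¬ ∀ i ∈ I, x ∈ V i := by
    intro 𝓘
    induction 𝓘 using Finset.induction_on with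
    | empty => exact ⟨U, hU, fun _ => subset_rfl, hc, by simp⟩
    | insert I 𝓘 _ ih =>
      obtain ⟨V, h1, h2, h3, h4⟩ := ih
      by_cases hI : I.card = n + 1
      · have hcard : Fintype.card κ = Fintype.card I := by rw [hκ, Fintype.card_coe, hI]
        let e : κ ≃ I := Fintype.equivOfCardEq hcard
        let π : ι → κ := fun i => if h : i ∈ I then e.symm ⟨i, h⟩ else Classical.arbitrary κ
        obtain ⟨W', g1, g2, g3, g4⟩ := h (fun l => ⋃ i, ⋃ _ : π i = l, V i)
          (fun l => isOpen_iUnion fun i => isOpen_iUnion fun _ => h1 i) (by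
            rw [eq_univ_iff_forall]
            intro x
            have : x ∈ ⋃ i, V i := by rw [h3]; trivial
            obtain ⟨i, hi⟩ := mem_iUnion.1 this
            exact mem_iUnion.2 ⟨π i, mem_iUnion.2 ⟨i, mem_iUnion.2 ⟨rfl, hi⟩⟩⟩)
        refine ⟨fun i => V i ∩ W' (π i), fun i => (h1 i).inter (g1 _),
          fun i => inter_subset_left.trans (h2 i), ?_, ?_⟩
        · rw [eq_univ_iff_forall]
          intro x
          have : x ∈ ⋃ i, W' i := by rw [g3]; trivial
          obtain ⟨l, hl⟩ := mem_iUnion.1 this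
          have := g2 l hl
          simp only [mem_iUnion] at this
          obtain ⟨i, rfl, hi⟩ := this
          exact mem_iUnion.2 ⟨i, hi, hl⟩
        · intro J hJ hJc x hx
          rcases Finset.mem_insert.1 hJ with rfl | hJ
          · have : x ∈ ⋂ l, W' l := by
              refine mem_iInter.2 fun l => ?_
              have h5 := (hx (e l) (e l).2).2
              have : π (e l) = l := by simp [π]
              rwa [this] at h5
            rw [g4] at this
            exact this
          · exact h4 J hJ hJc x fun i hi => (hx i hi).1
      · refine ⟨V, h1, h2, h3, fun J hJ hJc => ?_⟩
        rcases Finset.mem_insert.1 hJ with rfl | hJ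
        · exact (hI hJc).elim
        · exact h4 J hJ hJc
  obtain ⟨V, h1, h2, h3, h4⟩ := key Finset.univ
  refine ⟨V, h1, h2, h3, fun x => ?_⟩
  by_contra hx
  push Not at hx
  rw [Set.ncard_eq_toFinset_card'] at hx
  obtain ⟨I, hI, hIc⟩ := Finset.exists_subset_card_eq (Nat.succ_le_of_lt hx)
  exact h4 I (Finset.mem_univ _) hIc x fun i hi => by simpa using hI hi

lemma exists_pos_fun {X : Type} [MetricSpace X] {V : Set X} (hV : IsOpen V) :
    ∃ u : X → ℝ, Continuous u ∧ (∀ x, 0 ≤ u x) ∧ ∀ x, 0 < u x ↔ x ∈ V := by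
  rcases (Vᶜ).eq_empty_or_nonempty with h | h
  · refine ⟨fun _ => 1, continuous_const, fun _ => zero_le_one, fun x => ?_⟩
    simp [compl_empty_iff.1 h]
  · refine ⟨fun x => Metric.infDist x Vᶜ, Metric.continuous_infDist_pt _,
      fun x => Metric.infDist_nonneg, fun x => ?_⟩
    rw [← hV.isClosed_compl.notMem_iff_infDist_pos h, notMem_compl_iff]

lemma exists_partition {X : Type} [MetricSpace X] {σ : Type} [Fintype σ] {V : σ → Set X}
    (hV : ∀ s, IsOpen (V s)) (hc : (⋃ s, V s) = Set.univ) :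
    ∃ p : σ → X → ℝ, (∀ s, Continuous (p s)) ∧ (∀ s x, 0 ≤ p s x) ∧ (∀ x, ∑ s, p s x = 1) ∧
      ∀ s x, 0 < p s x ↔ x ∈ V s := by
  choose u hu1 hu2 hu3 using fun s => exists_pos_fun (hV s)
  have hpos : ∀ x, 0 < ∑ s, u s x := by
    intro x
    have : x ∈ ⋃ s, V s := by rw [hc]; trivial
    obtain ⟨s, hs⟩ := mem_iUnion.1 this
    exact Finset.sum_pos' (fun i _ => hu2 i x) ⟨s, Finset.mem_univ _, (hu3 s x).2 hs⟩
  refine ⟨fun s x => u s x / ∑ s, u s x, fun s => ?_, fun s x => ?_, fun x => ?_, fun s x => ?_⟩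
  · exact (hu1 s).div (continuous_finsetSum _ fun i _ => hu1 i) fun x => (hpos x).ne'
  · exact div_nonneg (hu2 s x) (hpos x).le
  · rw [← Finset.sum_div, div_self (hpos x).ne']
  · rw [← hu3, div_pos_iff_of_pos_right (hpos x)]

/-- General position. -/
lemma exists_generic {m : ℕ} {σ : Type} [Fintype σ] (c : σ → Fin m → ℝ) {ε : ℝ} (hε : 0 < ε) :
    ∃ v : σ → Fin m → ℝ, (∀ s, dist (v s) (c s) < ε) ∧
      ∀ T : Finset σ, T.card ≤ m → LinearIndepOn ℝ v (T : Set σ) := by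
  have key : ∀ S : Finset σ, ∃ v : σ → Fin m → ℝ, (∀ s, dist (v s) (c s) < ε) ∧
      ∀ T : Finset σ, T ⊆ S → T.card ≤ m → LinearIndepOn ℝ v (T : Set σ) := by
    intro S
    induction S using Finset.induction_on with
    | empty =>
      refine ⟨c, fun s => by simpa using hε, fun T hT _ => ?_⟩
      rw [Finset.subset_empty.1 hT]
      simp
    | insert a S ha ih =>
      obtain ⟨v, h1, h2⟩ := ih
      obtain ⟨w, hw, hw2⟩ : ∃ w : Fin m → ℝ, dist w (c a) < ε ∧
          ∀ T ∈ S.powerset.filter (fun T => T.card < m), w ∉ Submodule.span ℝ (v '' (T : Set σ)) := by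
        by_contra hcon
        push Not at hcon
        have hsub : Metric.ball (c a) ε ⊆ ⋃ T ∈ S.powerset.filter (fun T => T.card < m),
            (Submodule.span ℝ (v '' (T : Set σ)) : Set (Fin m → ℝ)) := by
          intro w hw
          obtain ⟨T, hT, hT2⟩ := hcon w hw
          exact mem_iUnion₂.2 ⟨T, hT, hT2⟩
        have h0 : MeasureTheory.volume (⋃ T ∈ S.powerset.filter (fun T => T.card < m),
            (Submodule.span ℝ (v '' (T : Set σ)) : Set (Fin m → ℝ))) = 0 := by
          refine (MeasureTheory.measure_biUnion_null_iff (Finset.countable_toSet _)).2 ?_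
          intro T hT
          refine MeasureTheory.Measure.addHaar_submodule _ _ fun htop => ?_
          have hT' : T.card < m := (Finset.mem_filter.1 hT).2
          have h5 : Module.finrank ℝ (Submodule.span ℝ (v '' (T : Set σ))) ≤ T.card := by
            rw [← Finset.coe_image]
            exact (finrank_span_finset_le_card _).trans Finset.card_image_le
          rw [htop, finrank_top, Module.finrank_fin_fun] at h5
          omega
        exact (Metric.measure_ball_pos MeasureTheory.volume (c a) hε).ne'
          (MeasureTheory.measure_mono_null hsub h0)
      refine ⟨Function.update v a w, fun s => ?_, fun T hT hTc => ?_⟩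
      · by_cases hs : s = a
        · subst hs; simpa using hw
        · rw [Function.update_of_ne hs]; exact h1 s
      · have hcongr : ∀ T : Finset σ, a ∉ T → EqOn v (Function.update v a w) (T : Set σ) := by
          intro T haT s hs
          rw [Function.update_of_ne]
          rintro rfl
          exact haT hs
        by_cases haT : a ∈ T
        · have hsub : T.erase a ⊆ S := by
            intro s hs
            rcases Finset.mem_insert.1 (hT (Finset.mem_of_mem_erase hs)) with h | h
            · exact (Finset.ne_of_mem_erase hs h).elim
            · exact h
          have hcd : (T.erase a).card < T.card := Finset.card_erase_lt_of_mem haT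
          rw [← Finset.insert_erase haT, Finset.coe_insert]
          refine LinearIndepOn.insert ?_ ?_
          · refine (linearIndepOn_congr (hcongr _ (Finset.notMem_erase a T))).1 ?_
            exact h2 _ hsub (by omega)
          · rw [Function.update_self, ← (hcongr _ (Finset.notMem_erase a T)).image_eq]
            exact hw2 _ (Finset.mem_filter.2 ⟨Finset.mem_powerset.2 hsub, by omega⟩)
        · refine (linearIndepOn_congr (hcongr _ haT)).1 (h2 T ?_ hTc)
          intro s hs
          rcases Finset.mem_insert.1 (hT hs) with h | h
          · exact (haT (h ▸ hs)).elim
          · exact h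
  obtain ⟨v, h1, h2⟩ := key Finset.univ
  exact ⟨v, h1, fun T hT => h2 T (Finset.subset_univ _) hT⟩

/-- Approximation of a bounded map by a generic polyhedral one. -/
lemma exists_approx {Y : Type} [MetricSpace Y] {d m : ℕ} (hY : OrdLE Y d)
    (h : Y → Fin m → ℝ) (hc : Continuous h) {C : ℝ} (hC : ∀ y, ‖h y‖ ≤ C)
    {κ : Type} [Finite κ] (W : κ → Set Y) (hW : ∀ i, IsOpen (W i)) (hWc : (⋃ i, W i) = Set.univ)
    {ε : ℝ} (hε : 0 < ε) :
    ∃ (σ : Type) (_ : Fintype σ) (p : σ → Y → ℝ) (v : σ → Fin m → ℝ) (τ : σ → κ),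
      (∀ s, Continuous (p s)) ∧ (∀ s x, 0 ≤ p s x) ∧ (∀ x, ∑ s, p s x = 1) ∧
      (∀ T : Finset σ, T.card ≤ m → LinearIndepOn ℝ v (T : Set σ)) ∧
      (∀ s x, 0 < p s x → x ∈ W (τ s)) ∧
      (∀ x, (Finset.univ.filter fun s => 0 < p s x).card ≤ d) ∧
      ∀ x, ‖∑ s, p s x • v s - h x‖ < ε := by
  obtain ⟨t, -, htf, ht⟩ := Metric.totallyBounded_iff.1
    (isCompact_closedBall (0 : Fin m → ℝ) C).totallyBounded (ε / 2) (half_pos hε) |>.imp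
      fun t ht => (⟨trivial, ht⟩ : True ∧ _)
  have : Finite t := htf
  have := Fintype.ofFinite κ
  have := Fintype.ofFinite t
  obtain ⟨V, g1, g2, g3, g4⟩ := hY (κ × t) inferInstance
    (fun s => W s.1 ∩ h ⁻¹' Metric.ball (s.2 : Fin m → ℝ) (ε / 2))
    (fun s => (hW _).inter (Metric.isOpen_ball.preimage hc)) (by
      rw [eq_univ_iff_forall]
      intro x
      have h1 : x ∈ ⋃ i, W i := by rw [hWc]; trivial
      obtain ⟨i, hi⟩ := mem_iUnion.1 h1
      have h2 : h x ∈ Metric.closedBall (0 : Fin m → ℝ) C := by simpa using hC x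
      obtain ⟨c, hct, hcx⟩ := mem_iUnion₂.1 (ht h2)
      exact mem_iUnion.2 ⟨(i, ⟨c, hct⟩), hi, hcx⟩)
  obtain ⟨p, p1, p2, p3, p4⟩ := exists_partition g1 g3
  obtain ⟨v, v1, v2⟩ := exists_generic (fun s : κ × t => (s.2 : Fin m → ℝ)) (half_pos hε)
  refine ⟨κ × t, inferInstance, p, v, Prod.fst, p1, p2, p3, v2, ?_, ?_, ?_⟩
  · intro s x hx
    exact (g2 s ((p4 s x).1 hx)).1
  · intro x
    refine le_trans (le_of_eq ?_) (g4 x)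
    rw [Set.ncard_eq_toFinset_card']
    congr 1
    ext s
    simp [p4]
  · intro x
    have h1 : ∑ s, p s x • v s - h x = ∑ s, p s x • (v s - h x) := by
      simp only [smul_sub, Finset.sum_sub_distrib, ← Finset.sum_smul, p3, one_smul]
    have h3 : ∀ s, ‖p s x • (v s - h x)‖ ≤ p s x * ε ∧ (0 < p s x → ‖p s x • (v s - h x)‖ < p s x * ε) := by
      intro s
      have hlt : 0 < p s x → ‖p s x • (v s - h x)‖ < p s x * ε := by
        intro hs
        rw [norm_smul, Real.norm_of_nonneg (p2 s x)]
        refine mul_lt_mul_of_pos_left ?_ hs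
        have h5 := (g2 s ((p4 s x).1 hs)).2
        have h6 : dist (h x) (s.2 : Fin m → ℝ) < ε / 2 := h5
        have h7 := v1 s
        rw [← dist_eq_norm]
        have := dist_triangle_right (v s) (h x) (s.2 : Fin m → ℝ)
        linarith
      refine ⟨?_, hlt⟩
      rcases (p2 s x).eq_or_lt with h0 | h0
      · simp [← h0]
      · exact (hlt h0).le
    rw [h1]
    refine lt_of_le_of_lt (norm_sum_le _ _) ?_
    have : ∑ s, p s x * ε = ε := by rw [← Finset.sum_mul, p3, one_mul]
    conv_rhs => rw [← this]
    refine Finset.sum_lt_sum (fun s _ => (h3 s).1) ?_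
    by_contra hcon
    push Not at hcon
    have : ∑ s, p s x = 0 := Finset.sum_eq_zero fun s hs => by
      by_contra h0
      have h0' : 0 < p s x := lt_of_le_of_ne (p2 s x) (Ne.symm h0)
      exact absurd ((h3 s).2 h0') (not_lt.2 (hcon s hs))
    rw [p3] at this
    exact one_ne_zero this

/-- A convex combination with few nonzero coefficients of generic vectors does not vanish. -/
lemma generic_ne_zero {m : ℕ} {σ : Type} [Fintype σ] {v : σ → Fin m → ℝ}
    (hv : ∀ T : Finset σ, T.card ≤ m → LinearIndepOn ℝ v (T : Set σ))
    (q : σ → ℝ) (hq : ∑ s, q s = 1) (T : Finset σ) (hT : T.card ≤ m)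
    (hqT : ∀ s, s ∉ T → q s = 0) : ∑ s, q s • v s ≠ 0 := by
  intro h0
  have h1 : ∑ s ∈ T, q s • v s = 0 := by
    rw [← h0]
    exact Finset.sum_subset (Finset.subset_univ _) fun s _ hs => by simp [hqT s hs]
  have h2 := linearIndepOn_finset_iff.1 (hv T hT) q h1
  have : ∑ s, q s = 0 := Finset.sum_eq_zero fun s _ => by
    by_cases hs : s ∈ T
    · exact h2 s hs
    · exact hqT s hs
  rw [hq] at this
  exact one_ne_zero this

lemma exists_nonvanishing {Y : Type} [MetricSpace Y] {m : ℕ} (hY : OrdLE Y m)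
    (h : Y → Fin m → ℝ) (hc : Continuous h) {C : ℝ} (hC : ∀ y, ‖h y‖ ≤ C)
    {ε : ℝ} (hε : 0 < ε) :
    ∃ h' : Y → Fin m → ℝ, Continuous h' ∧ (∀ y, ‖h' y - h y‖ < ε) ∧
      ∃ δ : ℝ, 0 < δ ∧ ∀ y, δ ≤ ‖h' y‖ := by
  obtain ⟨σ, _, p, v, τ, p1, p2, p3, hv, -, p5, p6⟩ := exists_approx hY h hc hC
    (fun _ : Unit => Set.univ) (fun _ => isOpen_univ) (Set.iUnion_const _) hε
  refine ⟨fun y => ∑ s, p s y • v s, ?_, p6, ?_⟩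
  · exact continuous_finsetSum _ fun s _ => (p1 s).smul continuous_const
  let T : Set (σ → ℝ) := ⋃ A ∈ (Finset.univ.filter fun A : Finset σ => A.card ≤ m),
    stdSimplex ℝ σ ∩ {q | ∀ s, s ∉ A → q s = 0}
  have hTc : IsCompact T := by
    refine Finset.isCompact_biUnion _ fun A _ => ?_
    refine (isCompact_stdSimplex ℝ σ).inter_right ?_
    simp only [ofPred_forall]
    refine isClosed_iInter fun s => isClosed_iInter fun _ => ?_
    exact isClosed_eq (continuous_apply s) continuous_const
  have hmem : ∀ y, (fun s => p s y) ∈ T := by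
    intro y
    refine mem_iUnion₂.2 ⟨Finset.univ.filter fun s => 0 < p s y, by simpa using p5 y, ?_, ?_⟩
    · exact ⟨fun s => p2 s y, p3 y⟩
    · intro s hs
      have : ¬ 0 < p s y := by simpa using hs
      exact le_antisymm (not_lt.1 this) (p2 s y)
  rcases T.eq_empty_or_nonempty with hT | hT
  · refine ⟨1, one_pos, fun y => ?_⟩
    have := hmem y
    rw [hT] at this
    exact this.elim
  · have hcont : Continuous fun q : σ → ℝ => ‖∑ s, q s • v s‖ :=
      (continuous_finsetSum _ fun s _ => (continuous_apply s).smul continuous_const).norm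
    obtain ⟨q, hq, hmin⟩ := hTc.exists_isMinOn hT hcont.continuousOn
    refine ⟨‖∑ s, q s • v s‖, ?_, fun y => hmin (hmem y)⟩
    obtain ⟨A, hA, hq1, hq2⟩ := mem_iUnion₂.1 hq
    rw [norm_pos_iff]
    exact generic_ne_zero hv q hq1.2 A (by simpa using hA) hq2

/-- Vector-valued Tietze extension with a bound. -/
lemma tietze_vec {X : Type} [MetricSpace X] {P : Set X} (hP : IsClosed P) {m : ℕ}
    (g : P → Fin m → ℝ) (hg : Continuous g) {ε : ℝ} (hε : 0 ≤ ε) (hgε : ∀ y, ‖g y‖ ≤ ε) :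
    ∃ G : X → Fin m → ℝ, Continuous G ∧ (∀ y : P, G y = g y) ∧ ∀ x, ‖G x‖ ≤ ε := by
  have : ∀ j : Fin m, ∃ G : X → ℝ, Continuous G ∧ (∀ y : P, G y = g y j) ∧ ∀ x, |G x| ≤ ε := by
    intro j
    have hb : ∀ y, |g y j| ≤ ε := fun y => (norm_le_pi_norm (g y) j).trans (hgε y)
    let f : BoundedContinuousFunction P ℝ := BoundedContinuousFunction.ofNormedAddCommGroup
      (fun y => g y j) ((continuous_apply j).comp hg) ε hb
    obtain ⟨G, hG1, hG2⟩ := f.exists_extension_norm_eq_of_isClosedEmbedding hP.isClosedEmbedding_subtypeVal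
    refine ⟨G, G.continuous, fun y => ?_, fun x => ?_⟩
    · exact congrFun hG2 y
    · have h1 : ‖f‖ ≤ ε := (BoundedContinuousFunction.norm_le hε).2 hb
      exact (G.norm_coe_le_norm x).trans (hG1.le.trans h1)
  choose G h1 h2 h3 using this
  refine ⟨fun x j => G j x, continuous_pi h1, fun y => funext fun j => h2 j y, fun x => ?_⟩
  exact (pi_norm_le_iff_of_nonneg hε).2 fun j => h3 j x


/-- Disjoint relatively open sets extend to disjoint open sets. -/
lemma exists_disjoint_ext {X : Type} [MetricSpace X] {P : Set X} {κ : Type}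
    (R : κ → Set P) (hR : ∀ i, IsOpen (R i)) (hd : ∀ i j, i ≠ j → ∀ y, y ∈ R i → y ∉ R j) :
    ∃ N : κ → Set X, (∀ i, IsOpen (N i)) ∧ (∀ i j, i ≠ j → ∀ x, x ∈ N i → x ∉ N j) ∧
      ∀ i, ∀ y : P, y ∈ R i → (y : X) ∈ N i := by
  have : ∀ i, ∀ y : R i, ∃ r > 0, Metric.ball (y : P) r ⊆ R i := fun i y =>
    Metric.isOpen_iff.1 (hR i) y y.2
  choose r hr hrR using this
  refine ⟨fun i => ⋃ y : R i, Metric.ball ((y : P) : X) (r i y / 2),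
    fun i => isOpen_iUnion fun y => Metric.isOpen_ball, ?_, ?_⟩
  · intro i j hij x hx hx'
    obtain ⟨y, hy⟩ := mem_iUnion.1 hx
    obtain ⟨z, hz⟩ := mem_iUnion.1 hx'
    have h1 : dist ((y : P) : X) ((z : P) : X) < r i y / 2 + r j z / 2 := by
      rw [Metric.mem_ball, dist_comm] at hy
      rw [Metric.mem_ball] at hz
      linarith [dist_triangle ((y : P) : X) x ((z : P) : X)]
    rcases le_total (r i y) (r j z) with h | h
    · have : (y : P) ∈ R j := hrR j z (by
        rw [Metric.mem_ball, Subtype.dist_eq]; linarith)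
      exact hd i j hij y y.2 this
    · have : (z : P) ∈ R i := hrR i y (by
        rw [Metric.mem_ball, Subtype.dist_eq, dist_comm]; linarith)
      exact hd i j hij z this z.2
  · intro i y hy
    exact mem_iUnion.2 ⟨⟨y, hy⟩, Metric.mem_ball_self (half_pos (hr i ⟨y, hy⟩))⟩

lemma exists_perturb {X : Type} [MetricSpace X] {m q : ℕ} {P O : Set X} (hP : IsClosed P)
    (hO : IsClosed O) (hdP : OrdLE P (m + 1)) (hdO : OrdLE O m)
    (W : Fin q → Set X) (hW : ∀ i, IsOpen (W i)) (hWc : ∀ x ∈ P, x ∉ O → ∃ i, x ∈ W i)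
    (h : X → Fin m → ℝ) (hc : Continuous h) {C : ℝ} (hC : ∀ y, ‖h y‖ ≤ C)
    {ε : ℝ} (hε : 0 < ε) :
    ∃ h' : X → Fin m → ℝ, Continuous h' ∧ (∀ y, ‖h' y - h y‖ < ε) ∧
      ∃ N : Fin q → Set X, (∀ i, IsOpen (N i)) ∧ (∀ i, N i ⊆ W i) ∧
        (∀ i j, i ≠ j → ∀ x, x ∈ N i → x ∉ N j) ∧ ∀ x ∈ P, h' x = 0 → ∃ i, x ∈ N i := by
  -- first step: make `h` nonzero on `O`
  obtain ⟨h1, h1c, h1ε, δ, hδ, h1δ⟩ : ∃ h1 : X → Fin m → ℝ, Continuous h1 ∧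
      (∀ y, ‖h1 y - h y‖ ≤ ε / 4) ∧ ∃ δ : ℝ, 0 < δ ∧ ∀ y ∈ O, δ ≤ ‖h1 y‖ := by
    obtain ⟨g, gc, gε, δ, hδ, gδ⟩ := exists_nonvanishing hdO (fun y : O => h y)
      (hc.comp continuous_subtype_val) (fun y => hC y) (show 0 < ε / 4 by linarith)
    obtain ⟨G, G1, G2, G3⟩ := tietze_vec hO (fun y : O => g y - h y)
      (gc.sub (hc.comp continuous_subtype_val)) (show 0 ≤ ε / 4 by linarith)
      (fun y => (gε y).le)
    refine ⟨fun x => h x + G x, hc.add G1, fun y => by simpa using G3 y, δ, hδ, fun y hy => ?_⟩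
    have : h y + G y = g ⟨y, hy⟩ := by
      rw [G2 ⟨y, hy⟩]; simp
    show δ ≤ ‖h y + G y‖
    rw [this]
    exact gδ _
  -- second step
  have h1C : ∀ y, ‖h1 y‖ ≤ C + ε / 4 := by
    intro y
    have := norm_add_le (h y) (h1 y - h y)
    rw [add_sub_cancel] at this
    linarith [h1ε y, hC y]
  let ε' := min (ε / 4) (δ / 4)
  have hε' : 0 < ε' := lt_min (by linarith) (by linarith)
  let W' : Option (Fin q) → Set P := fun o => Option.elim o {y : P | δ / 2 < ‖h1 y‖}
    fun i => Subtype.val ⁻¹' W i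
  have hW' : ∀ o, IsOpen (W' o) := by
    rintro (_ | i)
    · exact isOpen_lt continuous_const (h1c.comp continuous_subtype_val).norm
    · exact (hW i).preimage continuous_subtype_val
  obtain ⟨σ, _, p, v, τ, p1, p2, p3, hv, pτ, p5, p6⟩ := exists_approx hdP (fun y : P => h1 y)
    (h1c.comp continuous_subtype_val) (fun y => h1C y) W' hW' (by
      rw [eq_univ_iff_forall]
      intro y
      by_cases hy : (y : X) ∈ O
      · refine mem_iUnion.2 ⟨none, ?_⟩
        show δ / 2 < ‖h1 y‖
        linarith [h1δ y hy]
      · obtain ⟨i, hi⟩ := hWc y y.2 hy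
        exact mem_iUnion.2 ⟨some i, hi⟩) hε'
  have gc : Continuous fun y : P => ∑ s, p s y • v s :=
    continuous_finsetSum _ fun s _ => (p1 s).smul continuous_const
  obtain ⟨G, G1, G2, G3⟩ := tietze_vec hP (fun y : P => ∑ s, p s y • v s - h1 y)
      (gc.sub (h1c.comp continuous_subtype_val)) hε'.le (fun y => (p6 y).le)
  have hval : ∀ y : P, h1 y + G y = ∑ s, p s y • v s := by
    intro y
    rw [G2]; simp
  -- the pieces
  let supp : P → Finset σ := fun y => Finset.univ.filter fun s => 0 < p s y
  let R : Fin q → Set P := fun i => ⋃ A : Finset σ, ⋃ _ : A.card = m + 1 ∧ ∃ h : A.Nonempty,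
    τ h.choose = some i, {y | ∀ s ∈ A, 0 < p s y}
  have hRo : ∀ i, IsOpen (R i) := by
    intro i
    refine isOpen_iUnion fun A => isOpen_iUnion fun _ => ?_
    simp only [ofPred_forall]
    exact isOpen_biInter_finset fun s _ => isOpen_lt continuous_const (p1 s)
  have hsuppA : ∀ (A : Finset σ) (y : P), A.card = m + 1 → (∀ s ∈ A, 0 < p s y) → A = supp y := by
    intro A y hA hy
    refine Finset.eq_of_subset_of_card_le (fun s hs => by simpa [supp] using hy s hs) ?_
    rw [hA]
    exact p5 y
  have hRmem : ∀ i y, y ∈ R i → ∃ h : (supp y).Nonempty, τ h.choose = some i := by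
    intro i y hy
    simp only [R, mem_iUnion] at hy
    obtain ⟨A, ⟨hA, hA2⟩, hy⟩ := hy
    rw [hsuppA A y hA hy] at hA2
    exact hA2
  have hRd : ∀ i j, i ≠ j → ∀ y, y ∈ R i → y ∉ R j := by
    intro i j hij y hi hj
    obtain ⟨_, e1⟩ := hRmem i y hi
    obtain ⟨_, e2⟩ := hRmem j y hj
    rw [e1] at e2
    exact hij (Option.some.inj e2)
  obtain ⟨N, N1, N2, N3⟩ := exists_disjoint_ext R hRo hRd
  refine ⟨fun x => h1 x + G x, h1c.add G1, ?_, fun i => N i ∩ W i, fun i => (N1 i).inter (hW i),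
    fun i => inter_subset_right, fun i j hij x hx hx' => N2 i j hij x hx.1 hx'.1, ?_⟩
  · intro y
    have e : h1 y + G y - h y = (h1 y - h y) + G y := by abel
    rw [e]
    have := norm_add_le (h1 y - h y) (G y)
    have h3 : ‖G y‖ ≤ ε / 4 := (G3 y).trans (min_le_left _ _)
    linarith [h1ε y]
  · intro x hx h0
    have h0' : ∑ s, p s ⟨x, hx⟩ • v s = 0 := by rw [← hval]; exact h0
    have hcard : (supp ⟨x, hx⟩).card = m + 1 := by
      refine le_antisymm (p5 _) ?_
      by_contra hlt
      refine generic_ne_zero hv (fun s => p s ⟨x, hx⟩) (p3 _) (supp ⟨x, hx⟩) (by omega) ?_ h0'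
      intro s hs
      have : ¬ 0 < p s ⟨x, hx⟩ := by simpa [supp] using hs
      exact le_antisymm (not_lt.1 this) (p2 s _)
    have hne : (supp ⟨x, hx⟩).Nonempty := by
      rw [← Finset.card_pos]; omega
    have hs := hne.choose_spec
    have hpos : 0 < p hne.choose ⟨x, hx⟩ := by
      have := hs
      simp only [supp] at this
      exact (Finset.mem_filter.1 this).2
    have hmem := pτ _ _ hpos
    rcases hτ : τ hne.choose with _ | i
    · exfalso
      rw [hτ] at hmem
      have hmem' : δ / 2 < ‖h1 x‖ := hmem
      have h3 : ‖G x‖ ≤ δ / 4 := (G3 x).trans (min_le_right _ _)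
      have : h1 x = - G x := eq_neg_of_add_eq_zero_left h0
      rw [this, norm_neg] at hmem'
      linarith
    · rw [hτ] at hmem
      refine ⟨i, N3 i ⟨x, hx⟩ ?_, hmem⟩
      simp only [R, mem_iUnion]
      refine ⟨supp ⟨x, hx⟩, ⟨hcard, hne, hτ⟩, ?_⟩
      intro s hs
      simpa [supp] using hs

lemma isKTuple_bComplex {k : ℕ} {X : Type} {A : Fin (k + 1) → Set X} :
    IsKTuple (bComplex k) A ↔ ∀ x, ∃ i, x ∉ A i := by
  constructor
  · intro h x
    by_contra hx
    push Not at hx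
    exact h Finset.univ ⟨0, Finset.mem_univ _⟩ ⟨x, by simpa using hx⟩ rfl
  · intro h I _ hI hIu
    obtain ⟨x, hx⟩ := hI
    obtain ⟨i, hi⟩ := h x
    rw [hIu] at hx
    simp only [mem_iInter] at hx
    exact hi (hx i (Finset.mem_univ _))

lemma isClosed_kObs {m : ℕ} (K : Finset (Fin m) → Prop) {X : Type} [TopologicalSpace X]
    (U : Fin m → Set X) : IsClosed (KObs K U) := by
  rw [← isOpen_compl_iff, isOpen_iff_forall_mem_open]
  intro x hx
  simp only [KObs, mem_compl_iff, mem_ofPred_eq, not_not] at hx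
  obtain ⟨V, hV, hx⟩ := hx
  refine ⟨⋃ i, V i, fun y hy => ?_, isOpen_iUnion hV.1, hx⟩
  simp only [KObs, mem_compl_iff, mem_ofPred_eq, not_not]
  exact ⟨V, hV, hy⟩

lemma kObs_subset {m : ℕ} (K : Finset (Fin m) → Prop) {X : Type} [TopologicalSpace X]
    (U : Fin m → Set X) (hU : ∀ i, IsOpen (U i)) (hK : IsKTuple K U) :
    KObs K U ⊆ (⋃ i, U i)ᶜ := by
  intro x hx hxU
  exact hx ⟨U, ⟨hU, hK, fun _ => subset_rfl⟩, hxU⟩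

lemma OrdLE.kObs {m : ℕ} {K : Finset (Fin m) → Prop} {X : Type} [TopologicalSpace X]
    {U : Fin m → Set X} (hU : ∀ i, IsOpen (U i)) (hK : IsKTuple K U) {n : ℕ}
    (h : OrdLE (↥((⋃ i, U i)ᶜ)) n) : OrdLE (↥(KObs K U)) n := by
  refine h.closedEmbedding (f := Set.inclusion (kObs_subset K U hU hK)) ?_
  refine (IsClosedEmbedding.of_comp_iff (g := Subtype.val)
    (isOpen_iUnion hU).isClosed_compl.isClosedEmbedding_subtypeVal).1 ?_
  exact (isClosed_kObs K U).isClosedEmbedding_subtypeVal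

/-- The averaging criterion. -/
lemma cover_of_fun {X : Type} [TopologicalSpace X] {κ : Type} [Fintype κ] [Nonempty κ]
    (W : κ → Set X) (hW : ∀ i, IsOpen (W i)) (φ : κ → X → ℝ) (hφ : ∀ i, Continuous (φ i))
    (h1 : ∀ x, ∃ i j, φ i x ≠ φ j x) (h2 : ∀ i x, x ∉ W i → ∃ j, φ i x < φ j x) :
    ∃ V : κ → Set X, (∀ i, IsOpen (V i)) ∧ (∀ i, V i ⊆ W i) ∧ (⋃ i, V i) = Set.univ ∧
        (⋂ i, V i) = ∅ := by
  refine ⟨fun i => W i ∩ {x | ∑ j, φ j x < (Fintype.card κ : ℝ) * φ i x}, fun i => ?_,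
    fun i => inter_subset_left, ?_, ?_⟩
  · exact (hW i).inter (isOpen_lt (continuous_finsetSum _ fun j _ => hφ j)
      (continuous_const.mul (hφ i)))
  · rw [eq_univ_iff_forall]
    intro x
    obtain ⟨i, hi⟩ := Finite.exists_max fun i => φ i x
    refine mem_iUnion.2 ⟨i, ?_, ?_⟩
    · by_contra hx
      obtain ⟨j, hj⟩ := h2 i x hx
      exact absurd (hi j) (not_le.2 hj)
    · show ∑ j, φ j x < (Fintype.card κ : ℝ) * φ i x
      have : (Fintype.card κ : ℝ) * φ i x = ∑ _j : κ, φ i x := by simp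
      rw [this]
      refine Finset.sum_lt_sum (fun j _ => hi j) ?_
      by_contra hcon
      push Not at hcon
      obtain ⟨a, b, hab⟩ := h1 x
      exact hab ((le_antisymm (hi a) (hcon a (Finset.mem_univ _))).trans
        (le_antisymm (hcon b (Finset.mem_univ _)) (hi b)))
  · rw [eq_empty_iff_forall_notMem]
    intro x hx
    have h3 : ∀ i, ∑ j, φ j x < (Fintype.card κ : ℝ) * φ i x := fun i => (mem_iInter.1 hx i).2
    have h4 : ∑ i : κ, ∑ j, φ j x < ∑ i : κ, (Fintype.card κ : ℝ) * φ i x :=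
      Finset.sum_lt_sum_of_nonempty Finset.univ_nonempty fun i _ => h3 i
    rw [← Finset.mul_sum] at h4
    simp at h4

/-- The core theorem. -/
theorem core {k m : ℕ} {X : Type} [MetricSpace X]
    (H : ∀ F : Fin (k + 1) → Set X, (∀ i, IsClosed (F i)) → IsKTuple (bComplex k) F →
      ∃ U, KNbhd (bComplex k) F U ∧ OrdLE (↥((⋃ i, U i)ᶜ)) (m + 1) ∧
        OrdLE (↥(KObs (bComplex k) U)) m) : OrdLE X (k + m) := by
  refine ordLE_of_covers (κ := Fin (k + 1) ⊕ Fin m) (by simp; omega) ?_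
  intro W hW hWc
  obtain ⟨f, f1, f2, f3, f4⟩ := exists_partition hW hWc
  have f0 : ∀ c x, x ∉ W c → f c x = 0 := by
    intro c x hx
    rw [← f4] at hx
    exact le_antisymm (not_lt.1 hx) (f2 c x)
  have fle : ∀ c x, f c x ≤ 1 := by
    intro c x
    rw [← f3 x]
    exact Finset.single_le_sum (fun i _ => f2 i x) (Finset.mem_univ c)
  have f3' : ∀ x, ∑ i, f (Sum.inl i) x + ∑ j, f (Sum.inr j) x = 1 := by
    intro x
    rw [← f3 x, Fintype.sum_sum_type]
  set M : ℝ := (k : ℝ) + 1 + m with hM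
  have hMpos : 0 < M := by positivity
  let s : X → ℝ := fun x => ∑ i, f (Sum.inl i) x
  have hs : Continuous s := continuous_finsetSum _ fun i _ => f1 _
  let h : X → Fin m → ℝ := fun x j => f (Sum.inr j) x - 1 / M
  have hh : Continuous h := continuous_pi fun j => (f1 _).sub continuous_const
  have hhC : ∀ x, ‖h x‖ ≤ 1 + 1 / M := by
    intro x
    refine (pi_norm_le_iff_of_nonneg (by positivity)).2 fun j => ?_
    rw [Real.norm_eq_abs, abs_le]
    have h1 := f2 (Sum.inr j) x
    have h2 := fle (Sum.inr j) x
    have h3 : 0 < 1 / M := by positivity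
    constructor
    · show -(1 + 1 / M) ≤ f (Sum.inr j) x - 1 / M
      linarith
    · show f (Sum.inr j) x - 1 / M ≤ 1 + 1 / M
      linarith
  let δ : ℝ := 1 / (2 * M)
  have hδ : 0 < δ := by positivity
  let D : Fin (k + 1) → Set X := fun i => {x | ((k : ℝ) + 1) * f (Sum.inl i) x - s x ≤ -δ}
  have hD : ∀ i, IsClosed (D i) := fun i =>
    isClosed_le ((continuous_const.mul (f1 _)).sub hs) continuous_const
  have hDK : IsKTuple (bComplex k) D := by
    rw [isKTuple_bComplex]
    intro x
    by_contra hx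
    push Not at hx
    have h1 : ∑ i : Fin (k + 1), (((k : ℝ) + 1) * f (Sum.inl i) x - s x) < 0 :=
      Finset.sum_neg (fun i _ => lt_of_le_of_lt (hx i) (by linarith)) Finset.univ_nonempty
    rw [Finset.sum_sub_distrib, ← Finset.mul_sum] at h1
    simp [s] at h1
  obtain ⟨U, ⟨hUo, hUK, hDU⟩, hdP, hdO⟩ := H D hD hDK
  have hU0 := isKTuple_bComplex.1 hUK
  let W' : Fin (k + 1) → Set X := fun i => (closure (⋂ j, ⋂ _ : j ≠ i, U j))ᶜ
  let ε : ℝ := 1 / (2 * M * (m + 1))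
  have hε : 0 < ε := by positivity
  obtain ⟨h', h'c, h'ε, N, N1, N2, N3, N4⟩ := exists_perturb (isOpen_iUnion hUo).isClosed_compl
    (isClosed_kObs (bComplex k) U) hdP hdO W' (fun i => isClosed_closure.isOpen_compl) (by
      intro x hx hxO
      simp only [KObs, mem_ofPred_eq, not_not] at hxO
      obtain ⟨V, ⟨V1, V2, V3⟩, hxV⟩ := hxO
      obtain ⟨i, hi⟩ := mem_iUnion.1 hxV
      refine ⟨i, fun hcl => ?_⟩
      obtain ⟨y, hy, hy2⟩ := mem_closure_iff.1 hcl (V i) (V1 i) hi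
      obtain ⟨j, hj⟩ := isKTuple_bComplex.1 V2 y
      by_cases hji : j = i
      · exact hj (hji ▸ hy)
      · exact hj (V3 j (mem_iInter₂.1 hy2 j hji))) h hh hhC hε
  have h'j : ∀ x j, |h' x j - h x j| < ε := fun x j =>
    lt_of_le_of_lt (norm_le_pi_norm (h' x - h x) j) (h'ε x)
  let U' : Fin (k + 1) → Set X := fun i => U i ∪ N i
  have hU'o : ∀ i, IsOpen (U' i) := fun i => (hUo i).union (N1 i)
  have hU'0 : ∀ x, ∃ i, x ∉ U' i := by
    intro x
    by_contra hx
    push Not at hx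
    by_cases hN : ∃ i, x ∈ N i
    · obtain ⟨i, hi⟩ := hN
      refine N2 i hi (subset_closure (mem_iInter₂.2 fun j hj => ?_))
      rcases hx j with h5 | h5
      · exact h5
      · exact (N3 j i hj x h5 hi).elim
    · obtain ⟨i, hi⟩ := hU0 x
      rcases hx i with h5 | h5
      · exact hi h5
      · exact hN ⟨i, h5⟩
  choose u u1 u2 u3 using fun i => exists_pos_fun (hU'o i)
  have hu0 : ∀ x, ∃ i, u i x = 0 := by
    intro x
    obtain ⟨i, hi⟩ := hU'0 x
    rw [← u3] at hi
    exact ⟨i, le_antisymm (not_lt.1 hi) (u2 i x)⟩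
  refine cover_of_fun W hW (Sum.elim (fun i x => - u i x) fun j x => h' x j) ?_ ?_ ?_
  · rintro (i | j)
    · exact (u1 i).neg
    · exact (continuous_apply j).comp h'c
  · intro x
    by_contra hcon
    push Not at hcon
    obtain ⟨i, hi⟩ := hu0 x
    have hall : ∀ c, Sum.elim (fun i x => - u i x) (fun j x => h' x j) c x = 0 := by
      intro c
      rw [hcon c (Sum.inl i)]
      simp [hi]
    have hnot : ∀ i, x ∉ U' i := by
      intro i hx
      rw [← u3] at hx
      have := hall (Sum.inl i)
      simp only [Sum.elim_inl] at this
      linarith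
    obtain ⟨i, hi⟩ := N4 x (by
      intro hx
      obtain ⟨i, hi⟩ := mem_iUnion.1 hx
      exact hnot i (Or.inl hi)) (funext fun j => hall (Sum.inr j))
    exact hnot i (Or.inr hi)
  · rintro (i | j) x hx
    · have hfi := f0 _ x hx
      by_cases hsx : δ ≤ s x
      · have hxD : x ∈ D i := by
          show ((k : ℝ) + 1) * f (Sum.inl i) x - s x ≤ -δ
          rw [hfi]; linarith
        have hpos : 0 < u i x := (u3 i x).2 (Or.inl (hDU i hxD))
        obtain ⟨j, hj⟩ := hu0 x
        refine ⟨Sum.inl j, ?_⟩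
        simp only [Sum.elim_inl, hj]
        linarith
      · push Not at hsx
        have hex : ∃ j, 0 < h' x j := by
          by_contra hcon
          push Not at hcon
          have h1 : ∑ j, h' x j ≤ 0 := Finset.sum_nonpos fun j _ => hcon j
          have h2 : ∑ j, h x j ≤ ∑ j, (h' x j + ε) :=
            Finset.sum_le_sum fun j _ => by linarith [(abs_lt.1 (h'j x j)).1]
          rw [Finset.sum_add_distrib] at h2
          have h3 : ∑ j, h x j = (1 - s x) - m * (1 / M) := by
            simp only [h, Finset.sum_sub_distrib]
            have := f3' x
            simp only [s, Finset.sum_const, Finset.card_univ, Fintype.card_fin, nsmul_eq_mul]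
            linarith
          rw [h3] at h2
          simp only [Finset.sum_const, Finset.card_univ, Fintype.card_fin, nsmul_eq_mul] at h2
          have h4 : (m : ℝ) * ε ≤ δ := by
            simp only [ε, δ]
            rw [mul_one_div, div_le_div_iff₀ (by positivity) (by positivity)]
            have : 0 ≤ M := hMpos.le
            nlinarith
          have h5 : 1 - m * (1 / M) ≥ 2 * δ := by
            simp only [δ]
            have : 1 - m * (1 / M) = (k + 1) / M := by
              field_simp
              rw [hM]; ring
            rw [this]
            have : 2 * (1 / (2 * M)) = 1 / M := by field_simp
            rw [this]
            gcongr
            have : (0 : ℝ) ≤ k := by positivity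
            linarith
          linarith
        obtain ⟨j, hj⟩ := hex
        refine ⟨Sum.inr j, ?_⟩
        simp only [Sum.elim_inl, Sum.elim_inr]
        linarith [u2 i x]
    · have hfj := f0 _ x hx
      obtain ⟨i, hi⟩ := hu0 x
      refine ⟨Sum.inl i, ?_⟩
      simp only [Sum.elim_inl, Sum.elim_inr, hi]
      have h1 := (abs_lt.1 (h'j x j)).2
      have h2 : h x j = - (1 / M) := by simp [h, hfj]
      have h3 : ε ≤ 1 / M := by
        simp only [ε]
        have : (0 : ℝ) ≤ m := by positivity
        apply one_div_le_one_div_of_le hMpos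
        nlinarith
      linarith


/-- Enlarging pairs of disjoint closed sets. -/
lemma enlarge_pairs {X : Type} [MetricSpace X] {d : ℕ} (hX : OrdLE X d) (A B : Fin d → Set X)
    (hA : ∀ i, IsClosed (A i)) (hB : ∀ i, IsClosed (B i)) (hAB : ∀ i, Disjoint (A i) (B i)) :
    ∃ A' B' : Fin d → Set X, (∀ i, IsClosed (A' i)) ∧ (∀ i, IsClosed (B' i)) ∧
      (∀ i, Disjoint (A' i) (B' i)) ∧ (∀ i, A i ⊆ interior (A' i)) ∧
      (∀ i, B i ⊆ interior (B' i)) ∧ ∀ x, ∃ i, x ∈ interior (A' i) ∪ interior (B' i) := by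
  choose f f0 f1 f2 using fun i => exists_continuous_zero_one_of_isClosed (hA i) (hB i) (hAB i)
  let h : X → Fin d → ℝ := fun x i => 2 * f i x - 1
  have hc : Continuous h := continuous_pi fun i => by
    have := (f i).continuous
    fun_prop
  have hC : ∀ x, ‖h x‖ ≤ 1 := by
    intro x
    refine (pi_norm_le_iff_of_nonneg zero_le_one).2 fun i => ?_
    rw [Real.norm_eq_abs, abs_le]
    have h1 := (f2 i x).1
    have h2 := (f2 i x).2
    simp only [h]
    constructor <;> linarith
  obtain ⟨h', h'c, h'ε, δ, hδ, h'δ⟩ := exists_nonvanishing hX h hc hC (show (0 : ℝ) < 1 / 2 by norm_num)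
  have h'j : ∀ x j, |h' x j - h x j| < 1 / 2 := fun x j =>
    lt_of_le_of_lt (norm_le_pi_norm (h' x - h x) j) (h'ε x)
  have hci : ∀ i, Continuous fun x => h' x i := fun i => (continuous_apply i).comp h'c
  let η := min (δ / 2) (1 / 2)
  have hη : 0 < η := lt_min (by linarith) (by norm_num)
  have hη1 : η ≤ δ / 2 := min_le_left _ _
  have hη2 : η ≤ 1 / 2 := min_le_right _ _
  have hintA : ∀ i x, h' x i < -η → x ∈ interior {x | h' x i ≤ -η} := fun i x hx =>
    interior_maximal (show {x | h' x i < -η} ⊆ {x | h' x i ≤ -η} from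
      fun y (hy : h' y i < -η) => show h' y i ≤ -η from le_of_lt hy)
      (isOpen_lt (hci i) continuous_const) hx
  have hintB : ∀ i x, η < h' x i → x ∈ interior {x | η ≤ h' x i} := fun i x hx =>
    interior_maximal (show {x | η < h' x i} ⊆ {x | η ≤ h' x i} from
      fun y (hy : η < h' y i) => show η ≤ h' y i from le_of_lt hy)
      (isOpen_lt continuous_const (hci i)) hx
  refine ⟨fun i => {x | h' x i ≤ -η}, fun i => {x | η ≤ h' x i},
    fun i => isClosed_le (hci i) continuous_const, fun i => isClosed_le continuous_const (hci i),
    fun i => ?_, fun i x hx => ?_, fun i x hx => ?_, fun x => ?_⟩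
  · rw [Set.disjoint_left]
    intro x h1 h2
    have h1' : h' x i ≤ -η := h1
    have h2' : η ≤ h' x i := h2
    linarith
  · apply hintA
    have h1 : f i x = 0 := f0 i hx
    have h2 := (abs_lt.1 (h'j x i)).2
    simp only [h, h1] at h2
    linarith
  · apply hintB
    have h1 : f i x = 1 := f1 i hx
    have h2 := (abs_lt.1 (h'j x i)).1
    simp only [h, h1] at h2
    linarith
  · by_contra hcon
    push Not at hcon
    have : ‖h' x‖ ≤ η := by
      refine (pi_norm_le_iff_of_nonneg hη.le).2 fun i => ?_
      rw [Real.norm_eq_abs, abs_le]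
      constructor
      · by_contra hlt
        exact hcon i (Or.inl (hintA i x (not_le.1 hlt)))
      · by_contra hlt
        exact hcon i (Or.inr (hintB i x (not_le.1 hlt)))
    linarith [h'δ x]

def PairState (X : Type) [TopologicalSpace X] (d : ℕ) : Type :=
  {s : (Fin d → ℕ → Set X) × (Fin d → ℕ → Set X) //
    (∀ i j, IsClosed (s.1 i j)) ∧ (∀ i j, IsClosed (s.2 i j)) ∧ ∀ i j, Disjoint (s.1 i j) (s.2 i j)}

lemma pairState_step {X : Type} [MetricSpace X] {d : ℕ} (hX : OrdLE X d) (s : PairState X d)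
    (e : Fin d → ℕ) : ∃ s' : PairState X d,
      (∀ i j, s.1.1 i j ⊆ s'.1.1 i j) ∧ (∀ i j, s.1.2 i j ⊆ s'.1.2 i j) ∧
      (∀ i, s.1.1 i (e i) ⊆ interior (s'.1.1 i (e i))) ∧
      (∀ i, s.1.2 i (e i) ⊆ interior (s'.1.2 i (e i))) ∧
      ∀ x, ∃ i, x ∈ interior (s'.1.1 i (e i)) ∪ interior (s'.1.2 i (e i)) := by
  obtain ⟨⟨A, B⟩, hA, hB, hAB⟩ := s
  obtain ⟨A', B', a1, a2, a3, a4, a5, a6⟩ := enlarge_pairs hX (fun i => A i (e i))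
    (fun i => B i (e i)) (fun i => hA i _) (fun i => hB i _) (fun i => hAB i _)
  refine ⟨⟨(fun i j => if j = e i then A' i else A i j, fun i j => if j = e i then B' i else B i j),
    ?_, ?_, ?_⟩, ?_, ?_, ?_, ?_, ?_⟩
  · intro i j
    by_cases h : j = e i
    · simpa [h] using a1 i
    · simpa [h] using hA i j
  · intro i j
    by_cases h : j = e i
    · simpa [h] using a2 i
    · simpa [h] using hB i j
  · intro i j
    by_cases h : j = e i
    · simpa [h] using a3 i
    · simpa [h] using hAB i j
  · intro i j
    by_cases h : j = e i
    · simpa [h] using (a4 i).trans interior_subset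
    · simp [h]
  · intro i j
    by_cases h : j = e i
    · simpa [h] using (a5 i).trans interior_subset
    · simp [h]
  · intro i; simpa using a4 i
  · intro i; simpa using a5 i
  · intro x; simpa using a6 x

/-- Simultaneous partitions for countably many pairs. -/
lemma exists_partitions {X : Type} [MetricSpace X] {d : ℕ} (hX : OrdLE X d) (A B : ℕ → Set X)
    (hA : ∀ j, IsClosed (A j)) (hB : ∀ j, IsClosed (B j)) (hAB : ∀ j, Disjoint (A j) (B j)) :
    ∃ S T : Fin d → ℕ → Set X, (∀ i j, IsOpen (S i j)) ∧ (∀ i j, IsOpen (T i j)) ∧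
      (∀ i j, Disjoint (S i j) (T i j)) ∧ (∀ i j, A j ⊆ S i j) ∧ (∀ i j, B j ⊆ T i j) ∧
      ∀ x, ∃ i, ∀ j, x ∈ S i j ∪ T i j := by
  choose step hs1 hs2 hs3 hs4 hs5 using fun s e => pairState_step hX (d := d) s e
  obtain ⟨e, he⟩ := exists_surjective_nat (Fin d → ℕ)
  let s0 : PairState X d := ⟨(fun _ j => A j, fun _ j => B j), fun _ j => hA j, fun _ j => hB j,
    fun _ j => hAB j⟩
  let st : ℕ → PairState X d := fun t => Nat.rec s0 (fun t s => step s (e t)) t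
  have hst : ∀ t, st (t + 1) = step (st t) (e t) := fun t => rfl
  have mono1 : ∀ i j, Monotone fun t => (st t).1.1 i j := fun i j =>
    monotone_nat_of_le_succ fun t => by rw [hst]; exact hs1 _ _ i j
  have mono2 : ∀ i j, Monotone fun t => (st t).1.2 i j := fun i j =>
    monotone_nat_of_le_succ fun t => by rw [hst]; exact hs2 _ _ i j
  refine ⟨fun i j => ⋃ t, interior ((st t).1.1 i j), fun i j => ⋃ t, interior ((st t).1.2 i j),
    fun i j => isOpen_iUnion fun _ => isOpen_interior,
    fun i j => isOpen_iUnion fun _ => isOpen_interior, ?_, ?_, ?_, ?_⟩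
  · intro i j
    rw [Set.disjoint_left]
    intro x h1 h2
    obtain ⟨t1, h1⟩ := mem_iUnion.1 h1
    obtain ⟨t2, h2⟩ := mem_iUnion.1 h2
    exact Set.disjoint_left.1 ((st (max t1 t2)).2.2.2 i j)
      (mono1 i j (le_max_left _ _) (interior_subset h1))
      (mono2 i j (le_max_right _ _) (interior_subset h2))
  · intro i j x hx
    obtain ⟨t, ht⟩ := he fun _ => j
    refine mem_iUnion.2 ⟨t + 1, ?_⟩
    have h1 : x ∈ (st t).1.1 i j := mono1 i j (Nat.zero_le t) hx
    have h2 := hs3 (st t) (e t) i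
    rw [ht] at h2
    rw [hst, ht]
    exact h2 h1
  · intro i j x hx
    obtain ⟨t, ht⟩ := he fun _ => j
    refine mem_iUnion.2 ⟨t + 1, ?_⟩
    have h1 : x ∈ (st t).1.2 i j := mono2 i j (Nat.zero_le t) hx
    have h2 := hs4 (st t) (e t) i
    rw [ht] at h2
    rw [hst, ht]
    exact h2 h1
  · intro x
    by_contra hcon
    push Not at hcon
    choose j hj using hcon
    obtain ⟨t, ht⟩ := he j
    obtain ⟨i, hi⟩ := hs5 (st t) (e t) x
    refine hj i ?_
    rw [← hst, ht] at hi
    rcases hi with hi | hi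
    · exact Or.inl (mem_iUnion.2 ⟨t + 1, hi⟩)
    · exact Or.inr (mem_iUnion.2 ⟨t + 1, hi⟩)

/-- A version of zero-dimensionality of a subset `Z` of `X`. -/
def ZD {X : Type} [TopologicalSpace X] (Z : Set X) : Prop :=
  ∀ (q : ℕ) (W : Fin q → Set X), (∀ i, IsOpen (W i)) →
    ∃ V : Fin q → Set X, (∀ i, IsOpen (V i)) ∧ (∀ i, V i ⊆ W i) ∧
      (∀ i j, i ≠ j → ∀ x, x ∈ V i → x ∉ V j) ∧ ∀ x ∈ Z, (∃ i, x ∈ W i) → ∃ i, x ∈ V i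

lemma ZD.subtype {X : Type} [TopologicalSpace X] {Z : Set X} (h : ZD Z) (P : Set X) :
    ZD (Subtype.val ⁻¹' Z : Set P) := by
  intro q W hW
  have : ∀ i, ∃ W' : Set X, IsOpen W' ∧ Subtype.val ⁻¹' W' = W i := fun i =>
    isOpen_induced_iff.1 (hW i)
  choose W' h1 h2 using this
  obtain ⟨V, v1, v2, v3, v4⟩ := h q W' h1
  refine ⟨fun i => Subtype.val ⁻¹' V i, fun i => (v1 i).preimage continuous_subtype_val,
    fun i => ?_, fun i j hij x hx hx' => v3 i j hij _ hx hx', fun x hx hxW => ?_⟩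
  · rw [← h2]; exact preimage_mono (v2 i)
  · obtain ⟨i, hi⟩ := hxW
    rw [← h2] at hi
    exact v4 x hx ⟨i, hi⟩

/-- Families of Stone: a countable collection of disjoint families forming a base. -/
lemma exists_stone (X : Type) [MetricSpace X] :
    ∃ (𝓑 : ℕ → X → Set X) (A : ℕ → Set X), (∀ j c, IsOpen (𝓑 j c)) ∧ (∀ j, IsClosed (A j)) ∧
      (∀ j c c', c ≠ c' → ∀ x, x ∈ 𝓑 j c → x ∉ 𝓑 j c') ∧ (∀ j, A j ⊆ ⋃ c, 𝓑 j c) ∧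
      ∀ (W : Set X), IsOpen W → ∀ x ∈ W, ∃ j c, x ∈ A j ∧ x ∈ 𝓑 j c ∧ 𝓑 j c ⊆ W := by
  let lt : X → X → Prop := WellOrderingRel
  have wf : WellFounded lt := WellOrderingRel.isWellOrder.wf
  let r : ℕ → ℝ := fun n => 1 / ((n : ℝ) + 1)
  have hr : ∀ n, 0 < r n := fun n => Nat.one_div_pos_of_nat
  let E : ℕ × ℕ → X → Set X := fun p c =>
    {x | Metric.ball x (3 * r p.2) ⊆ Metric.ball c (r p.1) ∧
      ∀ c', lt c' c → x ∉ Metric.ball c' (r p.1)}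
  let Bf : ℕ × ℕ → X → Set X := fun p c => ⋃ x : E p c, Metric.ball (x : X) (r p.2)
  have hBd : ∀ p c c', lt c' c → ∀ x, x ∈ Bf p c → x ∉ Bf p c' := by
    intro p c c' hlt x hx hx'
    obtain ⟨y, hy⟩ := mem_iUnion.1 hx
    obtain ⟨z, hz⟩ := mem_iUnion.1 hx'
    refine y.2.2 c' hlt (z.2.1 ?_)
    rw [Metric.mem_ball] at hy hz ⊢
    rw [dist_comm] at hy
    linarith [dist_triangle (y : X) x z, hr p.2]
  let u : ℕ → ℕ × ℕ := Nat.unpair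
  refine ⟨fun j => Bf (u j), fun j => closure (⋃ c, E (u j) c),
    fun j c => isOpen_iUnion fun _ => Metric.isOpen_ball, fun j => isClosed_closure, ?_, ?_, ?_⟩
  · intro j c c' hne x hx hx'
    rcases (WellOrderingRel.isWellOrder (α := X)).toTrichotomous.rel_or_eq_or_rel_swap (a := c) (b := c') with h | h | h
    · exact hBd _ _ _ h x hx' hx
    · exact hne h
    · exact hBd _ _ _ h x hx hx'
  · intro j x hx
    obtain ⟨y, hy, hd⟩ := Metric.mem_closure_iff.1 hx (r (u j).2) (hr _)
    obtain ⟨c, hc⟩ := mem_iUnion.1 hy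
    exact mem_iUnion.2 ⟨c, mem_iUnion.2 ⟨⟨y, hc⟩, hd⟩⟩
  · intro W hW x hx
    obtain ⟨ρ, hρ, hρW⟩ := Metric.isOpen_iff.1 hW x hx
    obtain ⟨n, hn⟩ := exists_nat_one_div_lt (show 0 < ρ / 2 by linarith)
    have hne : {c | x ∈ Metric.ball c (r n)}.Nonempty := ⟨x, Metric.mem_ball_self (hr n)⟩
    let c := wf.min _ hne
    have hc : x ∈ Metric.ball c (r n) := wf.min_mem _ hne
    obtain ⟨ρ', hρ', hρW'⟩ := Metric.isOpen_iff.1 Metric.isOpen_ball x hc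
    obtain ⟨l, hl⟩ := exists_nat_one_div_lt (show 0 < ρ' / 3 by linarith)
    have hxE : x ∈ E (n, l) c := by
      refine ⟨(Metric.ball_subset_ball ?_).trans hρW', fun c' hc' hx' => ?_⟩
      · have : r l < ρ' / 3 := hl
        show 3 * r l ≤ ρ'
        linarith
      · exact wf.not_lt_min {c | x ∈ Metric.ball c (r n)} hx' hc'
    have huj : u (Nat.pair n l) = (n, l) := Nat.unpair_pair n l
    refine ⟨Nat.pair n l, c, ?_, ?_, ?_⟩
    · show x ∈ closure (⋃ c, E (u (Nat.pair n l)) c)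
      rw [huj]
      exact subset_closure (mem_iUnion.2 ⟨c, hxE⟩)
    · show x ∈ Bf (u (Nat.pair n l)) c
      rw [huj]
      exact mem_iUnion.2 ⟨⟨x, hxE⟩, Metric.mem_ball_self (hr l)⟩
    · show Bf (u (Nat.pair n l)) c ⊆ W
      rw [huj]
      intro z hz
      obtain ⟨y, hy⟩ := mem_iUnion.1 hz
      have h1 : z ∈ Metric.ball c (r n) := y.2.1 (Metric.ball_subset_ball (by
        show r l ≤ 3 * r l
        linarith [hr l]) hy)
      apply hρW
      rw [Metric.mem_ball] at h1 hc ⊢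
      have : r n < ρ / 2 := hn
      linarith [dist_triangle_right z x c]

lemma zd_of_partitions {X : Type} [TopologicalSpace X] (𝓑 : ℕ → X → Set X) (A : ℕ → Set X)
    (h1 : ∀ j c, IsOpen (𝓑 j c))
    (h2 : ∀ j c c', c ≠ c' → ∀ x, x ∈ 𝓑 j c → x ∉ 𝓑 j c')
    (h3 : ∀ (W : Set X), IsOpen W → ∀ x ∈ W, ∃ j c, x ∈ A j ∧ x ∈ 𝓑 j c ∧ 𝓑 j c ⊆ W)
    (S T : ℕ → Set X) (hS : ∀ j, IsOpen (S j)) (hT : ∀ j, IsOpen (T j))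
    (hST : ∀ j, Disjoint (S j) (T j)) (hAS : ∀ j, A j ⊆ S j) (hBT : ∀ j, (⋃ c, 𝓑 j c)ᶜ ⊆ T j) :
    ZD {x | ∀ j, x ∈ S j ∪ T j} := by
  intro q W hW
  let S' : ℕ → Fin q → Set X := fun j i => ⋃ c, ⋃ _ : 𝓑 j c ⊆ W i, S j ∩ 𝓑 j c
  let T' : ℕ → Fin q → Set X := fun j i => T j ∪ ⋃ c, ⋃ _ : ¬ 𝓑 j c ⊆ W i, S j ∩ 𝓑 j c
  have hS' : ∀ j i, IsOpen (S' j i) := fun j i =>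
    isOpen_iUnion fun c => isOpen_iUnion fun _ => (hS j).inter (h1 j c)
  have hT' : ∀ j i, IsOpen (T' j i) := fun j i =>
    (hT j).union (isOpen_iUnion fun c => isOpen_iUnion fun _ => (hS j).inter (h1 j c))
  have hdis : ∀ j i x, x ∈ S' j i → x ∉ T' j i := by
    intro j i x hx hx'
    simp only [S', T', mem_iUnion, mem_union] at hx hx'
    obtain ⟨c, hc, hx1, hx2⟩ := hx
    rcases hx' with hx' | ⟨c', hc', hx3, hx4⟩
    · exact Set.disjoint_left.1 (hST j) hx1 hx'
    · by_cases hcc : c = c'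
      · exact hc' (hcc ▸ hc)
      · exact h2 j c c' hcc x hx2 hx4
  have hSW : ∀ j i, S' j i ⊆ W i := by
    intro j i x hx
    simp only [S', mem_iUnion] at hx
    obtain ⟨c, hc, _, hx2⟩ := hx
    exact hc hx2
  have hcov : ∀ x, (∀ j, x ∈ S j ∪ T j) → ∀ j i, x ∈ S' j i ∪ T' j i := by
    intro x hx j i
    rcases hx j with h | h
    · have : x ∈ ⋃ c, 𝓑 j c := by
        by_contra hcon
        exact Set.disjoint_left.1 (hST j) h (hBT j hcon)
      obtain ⟨c, hc⟩ := mem_iUnion.1 this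
      by_cases hcW : 𝓑 j c ⊆ W i
      · exact Or.inl (mem_iUnion.2 ⟨c, mem_iUnion.2 ⟨hcW, h, hc⟩⟩)
      · exact Or.inr (Or.inr (mem_iUnion.2 ⟨c, mem_iUnion.2 ⟨hcW, h, hc⟩⟩))
    · exact Or.inr (Or.inl h)
  -- enumerate pairs by natural numbers
  let code : ℕ × Fin q → ℕ := fun p => Nat.pair p.1 p.2
  have hcode : Function.Injective code := by
    intro p p' h
    obtain ⟨e1, e2⟩ := Nat.pair_eq_pair.1 h
    exact Prod.ext e1 (Fin.ext e2)
  have hfin : ∀ p, {p' | code p' < code p}.Finite := fun p =>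
    (Set.finite_Iio (code p)).preimage hcode.injOn
  let V' : ℕ × Fin q → Set X := fun p => S' p.1 p.2 ∩ ⋂ p' ∈ {p' | code p' < code p}, T' p'.1 p'.2
  have hV' : ∀ p, IsOpen (V' p) := fun p =>
    (hS' _ _).inter ((hfin p).isOpen_biInter fun p' _ => hT' _ _)
  have hV'd : ∀ p p', code p < code p' → ∀ x, x ∈ V' p → x ∉ V' p' := by
    intro p p' hlt x hx hx'
    exact hdis _ _ x hx.1 (mem_iInter₂.1 hx'.2 p hlt)
  refine ⟨fun i => ⋃ j, V' (j, i), fun i => isOpen_iUnion fun j => hV' _, ?_, ?_, ?_⟩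
  · intro i x hx
    obtain ⟨j, hj⟩ := mem_iUnion.1 hx
    exact hSW _ _ hj.1
  · intro i i' hii x hx hx'
    obtain ⟨j, hj⟩ := mem_iUnion.1 hx
    obtain ⟨j', hj'⟩ := mem_iUnion.1 hx'
    have hne : code (j, i) ≠ code (j', i') := fun h => hii (congrArg Prod.snd (hcode h))
    rcases lt_or_gt_of_ne hne with h | h
    · exact hV'd _ _ h x hj hj'
    · exact hV'd _ _ h x hj' hj
  · intro x hx hxW
    obtain ⟨i, hi⟩ := hxW
    obtain ⟨j, c, hxA, hxB, hBW⟩ := h3 (W i) (hW i) x hi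
    have hxS : x ∈ S' j i := mem_iUnion.2 ⟨c, mem_iUnion.2 ⟨hBW, hAS j hxA, hxB⟩⟩
    have hex : ∃ n, ∃ p, code p = n ∧ x ∈ S' p.1 p.2 := ⟨_, (j, i), rfl, hxS⟩
    obtain ⟨p, hp, hxp⟩ := Nat.find_spec hex
    refine ⟨p.2, mem_iUnion.2 ⟨p.1, hxp, mem_iInter₂.2 fun p' hp' => ?_⟩⟩
    have hlt : code p' < Nat.find hex := hp ▸ hp'
    rcases hcov x hx p'.1 p'.2 with h | h
    · exact (Nat.find_min hex hlt ⟨p', rfl, h⟩).elim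
    · exact h

/-- `X` is a union of `N` zero-dimensional subsets. -/
def Dec (X : Type) [TopologicalSpace X] (N : ℕ) : Prop :=
  ∃ Z : ℕ → Set X, (∀ c, ZD (Z c)) ∧ ∀ x, ∃ c < N, x ∈ Z c

/-- The decomposition theorem. -/
theorem OrdLE.dec {X : Type} [MetricSpace X] {d : ℕ} (hX : OrdLE X d) : Dec X d := by
  obtain ⟨𝓑, A, b1, b2, b3, b4, b5⟩ := exists_stone X
  obtain ⟨S, T, s1, s2, s3, s4, s5, s6⟩ := exists_partitions hX A (fun j => (⋃ c, 𝓑 j c)ᶜ) b2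
    (fun j => (isOpen_iUnion fun c => b1 j c).isClosed_compl) (fun j =>
      Set.disjoint_left.2 fun x hx hx' => hx' (b4 j hx))
  refine ⟨fun c => if h : c < d then {x | ∀ j, x ∈ S ⟨c, h⟩ j ∪ T ⟨c, h⟩ j} else ∅, fun c => ?_,
    fun x => ?_⟩
  · by_cases h : c < d
    · simp only [h, dif_pos]
      exact zd_of_partitions 𝓑 A b1 b3 b5 _ _ (s1 _) (s2 _) (s3 _) (s4 _) (s5 _)
    · simp only [h, dif_neg, not_false_eq_true]
      intro q W hW
      exact ⟨fun _ => ∅, fun _ => isOpen_empty, fun _ => empty_subset _, fun _ _ _ _ h => h.elim,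
        fun x hx => hx.elim⟩
  · obtain ⟨i, hi⟩ := s6 x
    refine ⟨i, i.2, ?_⟩
    simp only [i.2, dif_pos]
    exact hi

/-- Partitions avoiding `k` zero-dimensional sets. -/
lemma exists_partition_avoiding {X : Type} [MetricSpace X] {k : ℕ} (Z : ℕ → Set X)
    (hZ : ∀ c, ZD (Z c)) (F : Fin (k + 1) → Set X) (hF : ∀ i, IsClosed (F i))
    (hFK : IsKTuple (bComplex k) F) :
    ∃ U, KNbhd (bComplex k) F U ∧ ∀ c < k, ∀ x ∈ Z c, x ∈ ⋃ i, U i := by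
  have hF0 := isKTuple_bComplex.1 hFK
  obtain ⟨v, v1, v2, v3⟩ := exists_iUnion_eq_closure_subset (u := fun i => (F i)ᶜ)
    (fun i => (hF i).isOpen_compl) (fun x => Set.toFinite _) (by
      rw [eq_univ_iff_forall]
      intro x
      obtain ⟨i, hi⟩ := hF0 x
      exact mem_iUnion.2 ⟨i, hi⟩)
  choose V w1 w2 w3 w4 using fun c => hZ c (k + 1) v v2
  let V' : Fin (k + 1) → Set X := fun i => ⋃ c : Fin k, V c i
  have hV'o : ∀ i, IsOpen (V' i) := fun i => isOpen_iUnion fun c => w1 c i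
  have hV'v : ∀ i, V' i ⊆ v i := fun i => iUnion_subset fun c => w2 c i
  have hV'0 : ∀ x, ∃ i, x ∉ V' i := by
    intro x
    by_contra hcon
    push Not at hcon
    choose c hc using fun i => mem_iUnion.1 (hcon i)
    obtain ⟨i, j, hij, hcij⟩ := Fintype.exists_ne_map_eq_of_card_lt c (by simp)
    refine w3 (c i) i j hij x (hc i) ?_
    rw [hcij]
    exact hc j
  choose u u1 u2 u3 using fun i => exists_pos_fun (hV'o i)
  let U' : Fin (k + 1) → Set X := fun i => {x | ((k : ℝ) + 1) * u i x < ∑ j, u j x}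
  have hU'o : ∀ i, IsOpen (U' i) := fun i =>
    isOpen_lt (continuous_const.mul (u1 i)) (continuous_finsetSum _ fun j _ => u1 j)
  have hU'0 : ∀ x, ∃ i, x ∉ U' i := by
    intro x
    by_contra hcon
    push Not at hcon
    have h1 : ∑ i : Fin (k + 1), ((k : ℝ) + 1) * u i x < ∑ i : Fin (k + 1), ∑ j, u j x :=
      Finset.sum_lt_sum_of_nonempty Finset.univ_nonempty fun i _ => hcon i
    rw [← Finset.mul_sum] at h1
    simp at h1
  have hzero : ∀ i x, x ∉ V' i → u i x = 0 := by
    intro i x hx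
    rw [← u3] at hx
    exact le_antisymm (not_lt.1 hx) (u2 i x)
  have hsum : ∀ x i, x ∈ V' i → 0 < ∑ j, u j x := fun x i hx =>
    Finset.sum_pos' (fun j _ => u2 j x) ⟨i, Finset.mem_univ _, (u3 i x).2 hx⟩
  have hin : ∀ x i j, x ∈ V' i → x ∉ V' j → x ∈ U' j := by
    intro x i j hi hj
    show ((k : ℝ) + 1) * u j x < ∑ j, u j x
    rw [hzero j x hj, mul_zero]
    exact hsum x i hi
  refine ⟨fun i => U' i ∪ (closure (v i))ᶜ, ⟨fun i => (hU'o i).union isClosed_closure.isOpen_compl,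
    isKTuple_bComplex.2 fun x => ?_, fun i x hx => Or.inr fun h => v3 i h hx⟩, ?_⟩
  · by_contra hcon
    push Not at hcon
    by_cases hG : ∃ i, x ∈ V' i
    · obtain ⟨i, hi⟩ := hG
      obtain ⟨j, hj⟩ := hU'0 x
      rcases hcon j with h | h
      · exact hj h
      · exact hj (hin x i j hi fun h' => h (subset_closure (hV'v j h')))
    · push Not at hG
      have : x ∈ ⋃ i, v i := by rw [v1]; trivial
      obtain ⟨i, hi⟩ := mem_iUnion.1 this
      rcases hcon i with h | h
      · have h' : ((k : ℝ) + 1) * u i x < ∑ j, u j x := h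
        rw [hzero i x (hG i), mul_zero, Finset.sum_eq_zero fun j _ => hzero j x (hG j)] at h'
        exact lt_irrefl _ h'
      · exact h (subset_closure hi)
  · intro c hc x hx
    have : x ∈ ⋃ i, v i := by rw [v1]; trivial
    obtain ⟨i, hi⟩ := w4 c x hx (mem_iUnion.1 this)
    have hi' : x ∈ V' i := mem_iUnion.2 ⟨⟨c, hc⟩, hi⟩
    obtain ⟨j, hj⟩ := hV'0 x
    exact mem_iUnion.2 ⟨j, Or.inl (hin x i j hi' hj)⟩


/-! ### Translation of dimension values -/

lemma Dim.ofOrdinal_le {a b : Ordinal.{0}} : Dim.ofOrdinal a ≤ Dim.ofOrdinal b ↔ a ≤ b := by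
  unfold Dim.ofOrdinal
  rw [WithTop.coe_le_coe, WithBot.coe_le_coe]

lemma Dim.ofOrdinal_lt {a b : Ordinal.{0}} : Dim.ofOrdinal a < Dim.ofOrdinal b ↔ a < b := by
  unfold Dim.ofOrdinal
  rw [WithTop.coe_lt_coe, WithBot.coe_lt_coe]

lemma Dim.minusOne_lt (a : Ordinal.{0}) : Dim.minusOne < Dim.ofOrdinal a := by
  unfold Dim.ofOrdinal Dim.minusOne
  rw [WithTop.coe_lt_coe]
  exact WithBot.bot_lt_coe a

lemma Dim.ofOrdinal_lt_top (a : Ordinal.{0}) : Dim.ofOrdinal a < ⊤ := WithTop.coe_lt_top _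

lemma covDim_le_iff {X : Type} [TopologicalSpace X] {n : ℕ} :
    covDim X ≤ Dim.ofOrdinal (n : Ordinal.{0}) ↔ OrdLE X (n + 1) := by
  unfold covDim
  split_ifs with h1 h2
  · exact ⟨fun _ => OrdLE.of_empty h1 _, fun _ => (Dim.minusOne_lt _).le⟩
  · rw [Dim.ofOrdinal_le, Nat.cast_le]
    constructor
    · intro h
      have h3 : CovDimLE X (sInf {n | CovDimLE X n}) := Nat.sInf_mem h2
      have h4 : OrdLE X (sInf {n | CovDimLE X n} + 1) := h3
      exact h4.mono (by omega)
    · intro h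
      exact Nat.sInf_le h
  · constructor
    · intro h
      exact absurd (Dim.ofOrdinal_lt_top _) (not_lt.2 h)
    · intro h
      exact absurd ⟨n, h⟩ h2

lemma covDim_lt_iff {X : Type} [TopologicalSpace X] {n : ℕ} :
    covDim X < Dim.ofOrdinal (n : Ordinal.{0}) ↔ OrdLE X n := by
  unfold covDim
  split_ifs with h1 h2
  · exact ⟨fun _ => OrdLE.of_empty h1 _, fun _ => Dim.minusOne_lt _⟩
  · rw [Dim.ofOrdinal_lt, Nat.cast_lt]
    constructor
    · intro h
      have h3 : CovDimLE X (sInf {n | CovDimLE X n}) := Nat.sInf_mem h2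
      have h4 : OrdLE X (sInf {n | CovDimLE X n} + 1) := h3
      exact h4.mono (by omega)
    · intro h
      rcases n with _ | n
      · exact absurd h.isEmpty h1
      · have : sInf {n | CovDimLE X n} ≤ n := Nat.sInf_le h
        omega
  · constructor
    · intro h
      exact absurd (h.trans (Dim.ofOrdinal_lt_top _)) (lt_irrefl _)
    · intro h
      exact absurd ⟨n, h.mono (Nat.le_succ n)⟩ h2

lemma kIndLE_iff {m : ℕ} (K : Finset (Fin m) → Prop) (X : Type) [TopologicalSpace X]
    (α : Ordinal.{0}) : KIndLE K X α ↔
    ∀ F : Fin m → Set X, (∀ i, IsClosed (F i)) → IsKTuple K F →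
      ∃ U : Fin m → Set X, (∀ i, IsOpen (U i)) ∧ IsKTuple K U ∧ (∀ i, F i ⊆ U i) ∧
        ((⋃ i, U i)ᶜ = (∅ : Set X) ∨
          ∃ β : Set.Iio α, KIndLE K (↥((⋃ i, U i)ᶜ)) β.1) := by
  unfold KIndLE
  conv_lhs => unfold KIndLeAux
  rw [WellFounded.fix_eq]
  rfl

lemma kIndLE_of_dec {k : ℕ} (n : ℕ) : ∀ (X : Type) [MetricSpace X] (N : ℕ), Dec X N →
    N ≤ k * (n + 1) → KIndLE (bComplex k) X (n : Ordinal.{0}) := by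
  induction n with
  | zero =>
    intro X _ N hX hN
    rw [kIndLE_iff]
    intro F hF hFK
    obtain ⟨Z, hZ, hZc⟩ := hX
    obtain ⟨U, hU, hUZ⟩ := exists_partition_avoiding Z hZ F hF hFK
    refine ⟨U, hU.1, hU.2.1, hU.2.2, Or.inl ?_⟩
    rw [Set.compl_empty_iff, Set.eq_univ_iff_forall]
    intro x
    obtain ⟨c, hc, hx⟩ := hZc x
    exact hUZ c (by simp at hN; omega) x hx
  | succ n ih =>
    intro X _ N hX hN
    rw [kIndLE_iff]
    intro F hF hFK
    obtain ⟨Z, hZ, hZc⟩ := hX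
    obtain ⟨U, hU, hUZ⟩ := exists_partition_avoiding Z hZ F hF hFK
    refine ⟨U, hU.1, hU.2.1, hU.2.2, Or.inr ⟨⟨(n : Ordinal.{0}), ?_⟩, ?_⟩⟩
    · show (n : Ordinal.{0}) < ((n + 1 : ℕ) : Ordinal.{0})
      exact_mod_cast Nat.lt_succ_self n
    · refine ih (↥((⋃ i, U i)ᶜ)) (N - k) ⟨fun c => Subtype.val ⁻¹' (Z (c + k)),
        fun c => (hZ (c + k)).subtype _, fun x => ?_⟩ ?_
      · obtain ⟨c, hc, hx⟩ := hZc x.1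
        have hck : k ≤ c := by
          by_contra h
          exact x.2 (hUZ c (by omega) x.1 hx)
        refine ⟨c - k, by omega, ?_⟩
        show x.1 ∈ Z (c - k + k)
        rwa [Nat.sub_add_cancel hck]
      · have : k * (n + 1 + 1) = k * (n + 1) + k := by ring
        omega

lemma ordLE_of_kIndLE {k : ℕ} (b : ℕ) : ∀ (X : Type) [MetricSpace X],
    KIndLE (bComplex k) X (b : Ordinal.{0}) → OrdLE X (k * (b + 1)) := by
  induction b using Nat.strong_induction_on with
  | _ b ih =>
    intro X _ h
    rw [kIndLE_iff] at h
    have key : OrdLE X (k + k * b) := by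
      refine core fun F hF hFK => ?_
      obtain ⟨U, u1, u2, u3, u4⟩ := h F hF hFK
      have hP : OrdLE (↥((⋃ i, U i)ᶜ)) (k * b) := by
        rcases u4 with u4 | ⟨⟨β, hβ⟩, u4⟩
        · exact OrdLE.of_empty (Set.isEmpty_coe_sort.2 u4) _
        · have hβ' : β < (b : Ordinal.{0}) := hβ
          obtain ⟨b', rfl⟩ := Ordinal.lt_omega0.1 (hβ'.trans (Ordinal.natCast_lt_omega0 b))
          have hb : b' < b := by exact_mod_cast hβ'
          exact (ih b' hb _ u4).mono (Nat.mul_le_mul_left k hb)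
      exact ⟨U, ⟨u1, u2, u3⟩, hP.mono (Nat.le_succ _), OrdLE.kObs u1 u2 hP⟩
    exact key.mono (by ring_nf; exact le_rfl)

lemma ordLE_of_kInd_lt {k n : ℕ} {X : Type} [MetricSpace X]
    (h : KInd (bComplex k) X < Dim.ofOrdinal (n : Ordinal.{0})) : OrdLE X (k * n) := by
  unfold KInd at h
  split_ifs at h with h1 h2
  · exact OrdLE.of_empty h1 _
  · rw [Dim.ofOrdinal_lt] at h
    have h3 : KIndLE (bComplex k) X (sInf {α | KIndLE (bComplex k) X α}) := csInf_mem h2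
    obtain ⟨b, hb⟩ := Ordinal.lt_omega0.1 (h.trans (Ordinal.natCast_lt_omega0 n))
    rw [hb] at h h3
    have hb' : b < n := by exact_mod_cast h
    exact (ordLE_of_kIndLE b X h3).mono (Nat.mul_le_mul_left k hb')
  · exact absurd (h.trans (Dim.ofOrdinal_lt_top _)) (lt_irrefl _)

lemma exists_special_tuple {k m : ℕ} {X : Type} [MetricSpace X]
    (hX : Dim.ofOrdinal ((k + m : ℕ) : Ordinal.{0}) ≤ covDim X) :
    ∃ F : Fin (k + 1) → Set X, (∀ i, IsClosed (F i)) ∧ IsKTuple (bComplex k) F ∧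
      ∀ U : Fin (k + 1) → Set X, KNbhd (bComplex k) F U →
        (covDim (↥(KObs (bComplex k) U)) = Dim.ofOrdinal ((m : ℕ) : Ordinal.{0}) ∨
          Dim.ofOrdinal ((m : ℕ) : Ordinal.{0}) < covDim (↥((⋃ i, U i)ᶜ))) := by
  by_contra hcon
  push Not at hcon
  refine absurd (covDim_lt_iff.2 (core (k := k) (m := m) (X := X) fun F hF hFK => ?_)) (not_lt.2 hX)
  obtain ⟨U, hU, h1, h2⟩ := hcon F hF hFK
  have hP := covDim_le_iff.1 h2
  exact ⟨U, hU, hP, covDim_lt_iff.1 (lt_of_le_of_ne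
    (covDim_le_iff.2 (OrdLE.kObs hU.1 hU.2.1 hP)) h1)⟩

lemma kInd_eq {k n : ℕ} (hk : 1 ≤ k) {X : Type} [MetricSpace X]
    (hX : covDim X = Dim.ofOrdinal ((k * (n + 1) - 1 : ℕ) : Ordinal.{0})) :
    KInd (bComplex k) X = Dim.ofOrdinal ((n : ℕ) : Ordinal.{0}) := by
  have e : k * (n + 1) = k * n + k := by ring
  have hup : OrdLE X (k * (n + 1)) := (covDim_le_iff.1 hX.le).mono (by omega)
  have hnot : ¬ OrdLE X (k * n) := fun h =>
    absurd (covDim_lt_iff.2 (h.mono (show k * n ≤ k * (n + 1) - 1 by omega))) (not_lt.2 hX.ge)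
  have hle : KIndLE (bComplex k) X (n : Ordinal.{0}) := kIndLE_of_dec n X _ hup.dec le_rfl
  refine le_antisymm ?_ (not_lt.1 fun h => hnot (ordLE_of_kInd_lt h))
  unfold KInd
  rw [if_neg fun h => hnot (OrdLE.of_empty h _), if_pos ⟨_, hle⟩, Dim.ofOrdinal_le]
  exact csInf_le' hle


theorem statement7 (k m : ℕ) (hk : 1 ≤ k) (X : Type) [MetricSpace X] :
    (Dim.ofOrdinal ((k + m : ℕ) : Ordinal.{0}) ≤ covDim X →
      ∃ F : Fin (k + 1) → Set X, (∀ i, IsClosed (F i)) ∧ IsKTuple (bComplex k) F ∧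
        ∀ U : Fin (k + 1) → Set X, KNbhd (bComplex k) F U →
          (covDim (↥(KObs (bComplex k) U)) = Dim.ofOrdinal ((m : ℕ) : Ordinal.{0}) ∨
            Dim.ofOrdinal ((m : ℕ) : Ordinal.{0}) < covDim (↥((⋃ i, U i)ᶜ)))) ∧
    (∀ n : ℕ, 1 ≤ n → covDim X = Dim.ofOrdinal ((k * (n + 1) - 1 : ℕ) : Ordinal.{0}) →
      KInd (bComplex k) X = Dim.ofOrdinal ((n : ℕ) : Ordinal.{0}) ∧
        KStr (bComplex k) X = 1) := by
  refine ⟨exists_special_tuple, fun n hn hX => ?_⟩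
  have hI := kInd_eq hk hX
  refine ⟨hI, ?_⟩
  unfold KStr
  rw [if_pos]
  refine ⟨⟨(n : Ordinal.{0}), by exact_mod_cast hn, hI⟩, ?_⟩
  have hkn : 1 ≤ k * n := Nat.mul_pos hk hn
  have e : k * (n + 1) - 1 = k + (k * n - 1) := by
    have : k * (n + 1) = k * n + k := by ring
    omega
  rw [e] at hX
  obtain ⟨F, hF, hFK, hFU⟩ := exists_special_tuple (k := k) (m := k * n - 1) hX.ge
  refine ⟨F, hF, hFK, fun U hU hlt hemp => ?_⟩
  rw [hI] at hlt
  have hP : OrdLE (↥((⋃ i, U i)ᶜ)) (k * n) := ordLE_of_kInd_lt hlt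
  rcases hFU U hU with h | h
  · have h' : covDim (↥(KObs (bComplex k) U)) <
        Dim.ofOrdinal ((k * n - 1 : ℕ) : Ordinal.{0}) :=
      covDim_lt_iff.2 (OrdLE.of_empty (Set.isEmpty_coe_sort.2 hemp) _)
    exact absurd h h'.ne
  · exact absurd (covDim_le_iff.2 (hP.mono (show k * n ≤ k * n - 1 + 1 by omega))) (not_le.2 h)

end
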